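/- Suppose f satisfies (R1), (R2), and −F_p/F_{p²} ∈ (κ_K^×)^{p−1}. Let L̃ be the normal closure of L over K inside an algebraic closure. Then Gal(L̃/K) is a p-group (equivalently, L̃/K is a p-extension) if and only if G_{p+1}/(F_p·F_{p²}) ∈ (κ_K^×)^{p−1}. -/

import Mathlib

open Polynomial IntermediateField

/-- The composite algebra structure `ℤ_[p] → ℚ_[p] → K`. -/
noncomputable instance zpAlgebra (p : ℕ) [Fact (Nat.Prime p)] (K : Type) [Field K]
    [Algebra ℚ_[p] K] : Algebra ℤ_[p] K :=
  ((algebraMap ℚ_[p] K).comp (algebraMap ℤ_[p] ℚ_[p])).toAlgebra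

section Ultrametric

variable {E : Type*} [NormedField E] [IsUltrametricDist E]

lemma ultra_add_le {s t : E} {B : ℝ} (hs : ‖s‖ ≤ B) (ht : ‖t‖ ≤ B) : ‖s + t‖ ≤ B :=
  (IsUltrametricDist.norm_add_le_max s t).trans (max_le hs ht)

lemma ultra_sub_le {s t : E} {B : ℝ} (hs : ‖s‖ ≤ B) (ht : ‖t‖ ≤ B) : ‖s - t‖ ≤ B := by
  rw [sub_eq_add_neg]
  exact ultra_add_le hs (by rwa [norm_neg])

lemma ultra_add_lt {s t : E} {B : ℝ} (hs : ‖s‖ < B) (ht : ‖t‖ < B) : ‖s + t‖ < B :=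
  (IsUltrametricDist.norm_add_le_max s t).trans_lt (max_lt hs ht)

lemma ultra_sub_lt {s t : E} {B : ℝ} (hs : ‖s‖ < B) (ht : ‖t‖ < B) : ‖s - t‖ < B := by
  rw [sub_eq_add_neg]
  exact ultra_add_lt hs (by rwa [norm_neg])

lemma norm_natCast_mul_le (n : ℕ) (t : E) : ‖(n : E) * t‖ ≤ ‖t‖ := by
  rw [norm_mul]
  exact mul_le_of_le_one_left (norm_nonneg _) (IsUltrametricDist.norm_natCast_le_one E n)

lemma norm_one_add_pow_sub_le {w : E} (hw : ‖w‖ ≤ 1) (m : ℕ) :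
    ‖(1 + w) ^ m - 1 - m * w‖ ≤ ‖w‖ ^ 2 := by
  induction m with
  | zero => simp
  | succ m ih =>
    have h1 : ‖1 + w‖ ≤ 1 := ultra_add_le (by simp) hw
    have : (1 + w) ^ (m + 1) - 1 - ((m + 1 : ℕ) : E) * w
        = ((1 + w) ^ m - 1 - m * w) * (1 + w) + m * w ^ 2 := by push_cast; ring
    rw [this]
    refine ultra_add_le ?_ ((norm_natCast_mul_le _ _).trans (by rw [norm_pow]))
    rw [norm_mul]
    exact (mul_le_of_le_one_right (norm_nonneg _) h1).trans ih

lemma norm_pow_sub_pow_le {s t : E} (hs : ‖s‖ ≤ 1) (ht : ‖t‖ ≤ 1) (m : ℕ) :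
    ‖s ^ m - t ^ m‖ ≤ ‖s - t‖ := by
  induction m with
  | zero => simp
  | succ m ih =>
    have : s ^ (m + 1) - t ^ (m + 1) = (s ^ m - t ^ m) * s + t ^ m * (s - t) := by ring
    rw [this]
    refine ultra_add_le ?_ ?_
    · rw [norm_mul]
      exact (mul_le_of_le_one_right (norm_nonneg _) hs).trans ih
    · rw [norm_mul, norm_pow]
      exact mul_le_of_le_one_left (norm_nonneg _) (pow_le_one₀ (norm_nonneg _) ht)

lemma norm_one_add_pow_sub_one_le {w : E} (hw : ‖w‖ ≤ 1) (m : ℕ) :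
    ‖(1 + w) ^ m - 1‖ ≤ ‖w‖ := by
  simpa using norm_pow_sub_pow_le (s := 1 + w) (t := 1) (ultra_add_le (by simp) hw) (by simp) m

lemma norm_add_pow_prime_sub_le {p : ℕ} (hp : p.Prime) {s t : E} (hs : ‖s‖ ≤ 1) (ht : ‖t‖ ≤ 1) :
    ‖(s + t) ^ p - (s ^ p + t ^ p)‖ ≤ ‖(p : E)‖ * ‖t‖ := by
  rw [add_pow_prime_eq hp, add_sub_cancel_left, norm_mul, norm_mul, norm_mul]
  have h : ‖∑ k ∈ Finset.Ioo 0 p, s ^ (k - 1) * t ^ (p - k - 1) * ((p.choose k / p : ℕ) : E)‖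
      ≤ 1 := by
    refine IsUltrametricDist.norm_sum_le_of_forall_le_of_nonneg zero_le_one fun k _ => ?_
    rw [mul_comm]
    refine (norm_natCast_mul_le _ _).trans ?_
    rw [norm_mul, norm_pow, norm_pow]
    exact mul_le_one₀ (pow_le_one₀ (norm_nonneg _) hs) (by positivity)
      (pow_le_one₀ (norm_nonneg _) ht)
  calc _ ≤ ‖(p : E)‖ * 1 * ‖t‖ * 1 := by gcongr
    _ = _ := by ring

lemma norm_lt_one_of_pow_sub_lt {p : ℕ} (hp : p.Prime) (hpE : ‖(p : E)‖ < 1) {s t : E}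
    (hs : ‖s‖ ≤ 1) (ht : ‖t‖ ≤ 1) (h : ‖s ^ p - t ^ p‖ < 1) : ‖s - t‖ < 1 := by
  have h1 := norm_add_pow_prime_sub_le hp (s := s - t) (t := t) (ultra_sub_le hs ht) ht
  rw [sub_add_cancel] at h1
  have h2 : ‖(s - t) ^ p‖ < 1 := by
    have : (s - t) ^ p = (s ^ p - t ^ p) - (s ^ p - ((s - t) ^ p + t ^ p)) := by ring
    rw [this]
    refine ultra_sub_lt h (h1.trans_lt ?_)
    exact (mul_le_of_le_one_right (norm_nonneg _) ht).trans_lt hpE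
  rw [norm_pow] at h2
  exact (pow_lt_one_iff_of_nonneg (norm_nonneg _) hp.ne_zero).1 h2

lemma norm_lt_one_of_pow_pow_sub_lt {p : ℕ} (hp : p.Prime) (hpE : ‖(p : E)‖ < 1) {s t : E}
    (hs : ‖s‖ ≤ 1) (ht : ‖t‖ ≤ 1) (k : ℕ) (h : ‖s ^ p ^ k - t ^ p ^ k‖ < 1) : ‖s - t‖ < 1 := by
  induction k with
  | zero => simpa using h
  | succ k ih =>
    rw [pow_succ, pow_mul, pow_mul] at h
    refine ih (norm_lt_one_of_pow_sub_lt hp hpE ?_ ?_ h) <;>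
    · rw [norm_pow]
      exact pow_le_one₀ (norm_nonneg _) (by assumption)

/-- If `z ^ p ≡ c ^ (p - 1) * z` modulo the maximal ideal, then `z` is an integer multiple of `c`
modulo the maximal ideal. -/
lemma exists_norm_sub_natCast_mul_lt {p : ℕ} [hp : Fact p.Prime] (hpE : ‖(p : E)‖ < 1) {z c : E}
    (hz : ‖z‖ ≤ 1) (hc : ‖c‖ ≤ 1) (h : ‖z ^ p - c ^ (p - 1) * z‖ < 1) :
    ∃ j : ℕ, ‖z - j * c‖ < 1 := by
  have hp1 := hp.out.one_lt
  rcases hc.lt_or_eq with hc' | hc'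
  · refine ⟨0, ?_⟩
    have : ‖z ^ p‖ < 1 := by
      have h2 : z ^ p = (z ^ p - c ^ (p - 1) * z) + c ^ (p - 1) * z := by ring
      rw [h2]
      refine ultra_add_lt h ?_
      rw [norm_mul, norm_pow]
      exact mul_lt_one_of_nonneg_of_lt_one_left (by positivity)
        (pow_lt_one₀ (norm_nonneg _) hc' (by omega)) hz
    rw [norm_pow] at this
    simpa using (pow_lt_one_iff_of_nonneg (norm_nonneg _) hp.out.ne_zero).1 this
  · have hc0 : c ≠ 0 := by rintro rfl; simp at hc'
    let A := (NormedField.valuation (K := E)).valuationSubring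
    have hA : ∀ x : E, x ∈ A ↔ ‖x‖ ≤ 1 := fun x => Iff.rfl
    have hm : ∀ x : A, IsLocalRing.residue A x = 0 ↔ ‖(x : E)‖ < 1 := by
      intro x
      rw [IsLocalRing.residue_eq_zero_iff]
      exact Valuation.mem_maximalIdeal_iff E (NormedField.valuation (K := E))
    let t : A := ⟨z / c, by rw [hA, norm_div, hc', div_one]; exact hz⟩
    have ht : IsLocalRing.residue A t ^ p = IsLocalRing.residue A t := by
      rw [← sub_eq_zero, ← map_pow, ← map_sub, hm]
      have : ((t ^ p - t : A) : E) = (z ^ p - c ^ (p - 1) * z) / c ^ p := by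
        push_cast
        obtain ⟨q, rfl⟩ : ∃ q, p = q + 1 := ⟨p - 1, by omega⟩
        simp only [t, Nat.add_sub_cancel, div_pow]
        field_simp
        ring
      rw [this, norm_div, norm_pow, hc', one_pow, div_one]
      exact h
    have : CharP (IsLocalRing.ResidueField A) p := by
      refine (CharP.charP_iff_prime_eq_zero hp.out).2 ?_
      rw [← map_natCast (IsLocalRing.residue A), hm]
      simpa using hpE
    have hbot := (Subfield.mem_bot_iff_pow_eq_self (IsLocalRing.ResidueField A) p).2 ht
    obtain ⟨j, hj⟩ : ∃ j : ℕ, (j : IsLocalRing.ResidueField A) = IsLocalRing.residue A t := by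
      rw [← ZMod.fieldRange_castHom_eq_bot p] at hbot
      obtain ⟨y, hy⟩ := hbot
      obtain ⟨j, rfl⟩ := ZMod.natCast_zmod_surjective y
      exact ⟨j, by simpa using hy⟩
    refine ⟨j, ?_⟩
    rw [eq_comm, ← sub_eq_zero, ← map_natCast (IsLocalRing.residue A), ← map_sub, hm] at hj
    have h3 : z - j * c = (z / c - j) * c := by field_simp
    rw [h3, norm_mul, hc', mul_one]
    simpa [t] using hj

end Ultrametric

section Polygon

variable {E : Type*} [NormedField E]

/-- The value at `x` of the monic polynomial of degree `n` with lower coefficients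
`F 1, …, F n`. -/
def monicValue (F : ℕ → E) (n : ℕ) (x : E) : E :=
  x ^ n + ∑ i ∈ Finset.range n, F (i + 1) * x ^ (n - (i + 1))

/-- The size conditions on the coefficients of the Eisenstein polynomial, for a uniformizer of
absolute value `r`. -/
structure PolygonData (p N : ℕ) (r : ℝ) (F : ℕ → E) (a b g : E) : Prop where
  odd_prime : 3 ≤ p
  prime : p.Prime
  deg : N = p * p
  pos : 0 < r
  lt_one : r < 1
  norm_p : ‖(p : E)‖ = r ^ N
  coeff_p : F p = p * a
  coeff_succ : F (p + 1) = p ^ 2 * g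
  coeff_last : F N = p * b
  norm_a : ‖a‖ = 1
  norm_b : ‖b‖ = 1
  norm_g : ‖g‖ = 1
  norm_coeff : ∀ i, 1 ≤ i → i < N → i ≠ p → ‖F i‖ ≤ r ^ (2 * N)
  norm_coeff_coprime : ∀ i, p + 2 ≤ i → i < N → i.Coprime p → ‖F i‖ ≤ r ^ (3 * N)

namespace PolygonData

variable {p N : ℕ} {r : ℝ} {F : ℕ → E} {a b g : E}

lemma three_mul_le (D : PolygonData p N r F a b g) : 3 * p ≤ N := by
  rw [D.deg]
  exact Nat.mul_le_mul_right p D.odd_prime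

lemma pow_le_pow (D : PolygonData p N r F a b g) {m n : ℕ} (h : m ≤ n) : r ^ n ≤ r ^ m :=
  pow_le_pow_of_le_one D.pos.le D.lt_one.le h

lemma norm_coeff_le (D : PolygonData p N r F a b g) {i : ℕ} (h1 : 1 ≤ i) (h2 : i ≤ N) :
    ‖F i‖ ≤ r ^ N := by
  rcases h2.eq_or_lt with rfl | h2
  · rw [D.coeff_last, norm_mul, D.norm_b, D.norm_p, mul_one]
  · by_cases hi : i = p
    · rw [hi, D.coeff_p, norm_mul, D.norm_a, D.norm_p, mul_one]
    · exact (D.norm_coeff i h1 h2 hi).trans (D.pow_le_pow (by omega))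

lemma norm_terms (D : PolygonData p N r F a b g) {x : E} (hxr : ‖x‖ = r) (u w : E) :
    ‖x ^ N * u ^ p‖ = r ^ N * ‖u‖ ^ p ∧
    ‖p * a * x ^ (N - p) * u‖ = r ^ (2 * N - p) * ‖u‖ ∧
    ‖p ^ 2 * g * x ^ (N - p - 1) * w‖ = r ^ (3 * N - p - 1) * ‖w‖ := by
  have hN := D.three_mul_le
  have hp := D.odd_prime
  refine ⟨by rw [norm_mul, norm_pow, norm_pow, hxr], ?_, ?_⟩
  · rw [norm_mul, norm_mul, norm_mul, norm_pow, hxr, D.norm_a, D.norm_p, mul_one, ← pow_add]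
    congr 2
    omega
  · rw [norm_mul, norm_mul, norm_mul, norm_pow, norm_pow, hxr, D.norm_g, D.norm_p, mul_one,
      ← pow_mul, ← pow_add]
    congr 2
    omega

lemma norm_p_lt_one (D : PolygonData p N r F a b g) : ‖(p : E)‖ < 1 := by
  have := D.three_mul_le
  have := D.odd_prime
  rw [D.norm_p]
  exact pow_lt_one₀ D.pos.le D.lt_one (by omega)

variable [IsUltrametricDist E]

lemma norm_pow_add_le (D : PolygonData p N r F a b g) {x : E} (hx : ‖x‖ ≤ 1)
    (h : monicValue F N x = 0) : ‖x ^ N + p * b‖ ≤ r ^ N * ‖x‖ := by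
  have hN := D.three_mul_le
  have hp := D.odd_prime
  obtain ⟨M, rfl⟩ : ∃ M, N = M + 1 := ⟨N - 1, by omega⟩
  rw [monicValue, Finset.sum_range_succ, D.coeff_last] at h
  have : x ^ (M + 1) + p * b
      = -∑ i ∈ Finset.range M, F (i + 1) * x ^ (M + 1 - (i + 1)) := by
    rw [Nat.sub_self, pow_zero, mul_one] at h
    linear_combination h
  rw [this, norm_neg]
  refine IsUltrametricDist.norm_sum_le_of_forall_le_of_nonneg
    (mul_nonneg (pow_nonneg D.pos.le _) (norm_nonneg _)) fun i hi => ?_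
  rw [Finset.mem_range] at hi
  rw [norm_mul, norm_pow]
  exact mul_le_mul (D.norm_coeff_le (by omega) (by omega))
    (pow_le_of_le_one (norm_nonneg _) hx (by omega)) (by positivity) (pow_nonneg D.pos.le _)

lemma norm_root_pow (D : PolygonData p N r F a b g) {x : E}
    (h : monicValue F N x = 0) : ‖x‖ = r := by
  have hN := D.three_mul_le
  have hp := D.odd_prime
  have hrN : r ^ N < 1 := pow_lt_one₀ D.pos.le D.lt_one (by omega)
  have hrN' : 0 < r ^ N := pow_pos D.pos _
  have hx : ‖x‖ < 1 := by
    by_contra! hx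
    have h1 : ‖x ^ N‖ ≤ r ^ N * ‖x‖ ^ N := by
      rw [monicValue, add_eq_zero_iff_eq_neg] at h
      rw [h, norm_neg]
      refine IsUltrametricDist.norm_sum_le_of_forall_le_of_nonneg (by positivity) fun i hi => ?_
      rw [Finset.mem_range] at hi
      rw [norm_mul, norm_pow]
      gcongr
      · exact D.norm_coeff_le (by omega) (by omega)
      · omega
    rw [norm_pow] at h1
    nlinarith [one_le_pow₀ hx (n := N)]
  have h1 := D.norm_pow_add_le hx.le h
  have h2 : ‖(p : E) * b‖ = r ^ N := by rw [norm_mul, D.norm_b, D.norm_p, mul_one]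
  have h3 : ‖x ^ N‖ = r ^ N := by
    rw [← h2]
    refine IsUltrametricDist.norm_eq_of_add_norm_lt_max (lt_max_of_lt_right ?_)
    rw [h2]
    exact h1.trans_lt (mul_lt_of_lt_one_right hrN' hx)
  rw [norm_pow] at h3
  exact (pow_left_inj₀ (norm_nonneg _) D.pos.le (by omega)).1 h3

/-- Expansion of the difference of the values at `x` and `x * (1 + w)`. -/
lemma norm_expansion_le (D : PolygonData p N r F a b g) {x w : E}
    (hx : monicValue F N x = 0) (hy : monicValue F N (x * (1 + w)) = 0) (hw : ‖w‖ ≤ 1) :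
    ‖x ^ N * ((1 + w) ^ N - 1) + p * a * x ^ (N - p) * ((1 + w) ^ (N - p) - 1)
      + p ^ 2 * g * x ^ (N - p - 1) * ((1 + w) ^ (N - p - 1) - 1)‖
      ≤ max (r ^ (2 * N) * ‖(1 + w) ^ p - 1‖) (r ^ (3 * N - p + 1) * ‖w‖) := by
  have hN := D.three_mul_le
  have hp := D.odd_prime
  have hr := D.pos
  have hxr : ‖x‖ = r := D.norm_root_pow hx
  have hu1 : ‖(1 + w) ^ p - 1‖ ≤ 1 := (norm_one_add_pow_sub_one_le hw p).trans hw
  set T : ℕ → E := fun i => F (i + 1) * x ^ (N - (i + 1)) * ((1 + w) ^ (N - (i + 1)) - 1) with hT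
  have hsum : x ^ N * ((1 + w) ^ N - 1) + ∑ i ∈ Finset.range N, T i = 0 := by
    have : ∑ i ∈ Finset.range N, T i = (∑ i ∈ Finset.range N,
        F (i + 1) * (x * (1 + w)) ^ (N - (i + 1))) - ∑ i ∈ Finset.range N,
        F (i + 1) * x ^ (N - (i + 1)) := by
      rw [← Finset.sum_sub_distrib]
      refine Finset.sum_congr rfl fun i _ => ?_
      rw [hT, mul_pow]
      ring
    rw [this]
    rw [monicValue] at hx hy
    rw [mul_pow] at hy
    linear_combination hy - hx
  have hsplit : x ^ N * ((1 + w) ^ N - 1) + p * a * x ^ (N - p) * ((1 + w) ^ (N - p) - 1)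
      + p ^ 2 * g * x ^ (N - p - 1) * ((1 + w) ^ (N - p - 1) - 1)
      = -∑ i ∈ Finset.range N,
        (T i - (if i = p - 1 then T i else 0) - (if i = p then T i else 0)) := by
    rw [Finset.sum_sub_distrib, Finset.sum_sub_distrib, Finset.sum_ite_eq', Finset.sum_ite_eq',
      if_pos (Finset.mem_range.2 (by omega)), if_pos (Finset.mem_range.2 (by omega))]
    have e1 : T (p - 1) = p * a * x ^ (N - p) * ((1 + w) ^ (N - p) - 1) := by
      simp only [hT]
      rw [Nat.sub_add_cancel (by omega), D.coeff_p]
    have e2 : T p = p ^ 2 * g * x ^ (N - p - 1) * ((1 + w) ^ (N - p - 1) - 1) := by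
      simp only [hT]
      rw [D.coeff_succ, Nat.sub_add_eq]
    rw [e1, e2]
    linear_combination hsum
  rw [hsplit, norm_neg]
  refine IsUltrametricDist.norm_sum_le_of_forall_le_of_nonneg (by positivity) fun i hi => ?_
  rw [Finset.mem_range] at hi
  by_cases h1 : i = p - 1
  · rw [if_pos h1, if_neg (by omega)]
    simpa using Or.inl (by positivity)
  by_cases h2 : i = p
  · rw [if_neg h1, if_pos h2]
    simpa using Or.inl (by positivity)
  rw [if_neg h1, if_neg h2, sub_zero, sub_zero]
  simp only [hT]
  by_cases hiN : i + 1 = N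
  · rw [hiN]
    simpa using Or.inl (by positivity)
  have hw' := norm_one_add_pow_sub_one_le hw (N - (i + 1))
  have hF := D.norm_coeff (i + 1) (by omega) (by omega) (by omega)
  by_cases hd : p ∣ i + 1
  · refine le_max_of_le_left ?_
    obtain ⟨j, hj⟩ : p ∣ N - (i + 1) := (Nat.dvd_sub (D.deg ▸ dvd_mul_right p p) hd)
    have h3 : ‖(1 + w) ^ (N - (i + 1)) - 1‖ ≤ ‖(1 + w) ^ p - 1‖ := by
      have := norm_one_add_pow_sub_one_le hu1 j
      rwa [add_sub_cancel, ← pow_mul, ← hj] at this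
    rw [norm_mul, norm_mul, norm_pow]
    calc _ ≤ r ^ (2 * N) * 1 * ‖(1 + w) ^ p - 1‖ := by
          gcongr
          rw [hxr]
          exact pow_le_one₀ hr.le D.lt_one.le
      _ = _ := by ring
  · refine le_max_of_le_right ?_
    have hco : (i + 1).Coprime p := ((D.prime.coprime_iff_not_dvd).2 hd).symm
    rw [norm_mul, norm_mul, norm_pow, hxr]
    refine mul_le_mul ?_ hw' (norm_nonneg _) (by positivity)
    rcases lt_or_ge i p with h | h
    · calc _ ≤ r ^ (2 * N) * r ^ (N - (i + 1)) := by gcongr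
        _ = r ^ (2 * N + (N - (i + 1))) := (pow_add _ _ _).symm
        _ ≤ _ := D.pow_le_pow (by omega)
    · calc _ ≤ r ^ (3 * N) * 1 := by
            gcongr
            · exact D.norm_coeff_coprime _ (by omega) (by omega) hco
            · exact pow_le_one₀ hr.le D.lt_one.le
        _ ≤ _ := by rw [mul_one]; exact D.pow_le_pow (by omega)

/-- The three terms of the expansion at a root `x` that determine the ramification polygon. -/
lemma norm_dominant_le (D : PolygonData p N r F a b g) {x w : E}
    (hx : monicValue F N x = 0) (hy : monicValue F N (x * (1 + w)) = 0) (hw : ‖w‖ ≤ 1) :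
    ‖x ^ N * ((1 + w) ^ p - 1) ^ p - p * a * x ^ (N - p) * ((1 + w) ^ p - 1)
      - p ^ 2 * g * x ^ (N - p - 1) * w‖
      ≤ max (max (r ^ (2 * N) * ‖(1 + w) ^ p - 1‖) (r ^ (3 * N - p + 1) * ‖w‖))
        (max (r ^ (2 * N - p) * ‖(1 + w) ^ p - 1‖ ^ 2) (r ^ (3 * N - p - 1) * ‖w‖ ^ 2)) := by
  have hN := D.three_mul_le
  have hp := D.odd_prime
  have hr := D.pos
  have hxr : ‖x‖ = r := D.norm_root_pow hx
  have hE := D.norm_expansion_le hx hy hw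
  set u := (1 + w) ^ p - 1 with hu
  have hu1 : ‖u‖ ≤ 1 := (norm_one_add_pow_sub_one_le hw p).trans hw
  have hwu : (1 + w) ^ p = 1 + u := by rw [hu]; ring
  have hmul : p * (p - 1) = N - p := by rw [D.deg, Nat.mul_sub, mul_one]
  have e1 : (1 + w) ^ N = (1 + u) ^ p := by rw [D.deg, pow_mul, hwu]
  have e2 : (1 + w) ^ (N - p) = (1 + u) ^ (p - 1) := by rw [← hmul, pow_mul, hwu]
  rw [e1, e2] at hE
  have hc1 : ((p - 1 : ℕ) : E) = p - 1 := by rw [Nat.cast_sub (by omega), Nat.cast_one]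
  have hc2 : ((N - p - 1 : ℕ) : E) + 1 = p * ((p - 1 : ℕ) : E) := by
    have h : N - p - 1 + 1 = p * (p - 1) := by omega
    exact_mod_cast congrArg (Nat.cast (R := E)) h
  have b1 := norm_add_pow_prime_sub_le D.prime (s := 1) (t := u) (by simp) hu1
  have b2 := norm_one_add_pow_sub_le hu1 (p - 1)
  have b3 := norm_one_add_pow_sub_le hw (N - p - 1)
  rw [one_pow, D.norm_p] at b1
  have key : x ^ N * u ^ p - p * a * x ^ (N - p) * u - p ^ 2 * g * x ^ (N - p - 1) * w
      = (x ^ N * ((1 + u) ^ p - 1) + p * a * x ^ (N - p) * ((1 + u) ^ (p - 1) - 1)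
        + p ^ 2 * g * x ^ (N - p - 1) * ((1 + w) ^ (N - p - 1) - 1))
      - x ^ N * ((1 + u) ^ p - (1 + u ^ p))
      - p * a * x ^ (N - p) * ((1 + u) ^ (p - 1) - 1 - ((p - 1 : ℕ) : E) * u)
      - p * (p * a * x ^ (N - p) * u)
      - p ^ 2 * g * x ^ (N - p - 1) * ((1 + w) ^ (N - p - 1) - 1 - ((N - p - 1 : ℕ) : E) * w)
      - p * (((p - 1 : ℕ) : E) * (p ^ 2 * g * x ^ (N - p - 1) * w)) := by
    linear_combination -(p * a * x ^ (N - p) * u) * hc1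
      - (p ^ 2 * g * x ^ (N - p - 1) * w) * hc2
  rw [key]
  refine ultra_sub_le (ultra_sub_le (ultra_sub_le (ultra_sub_le (ultra_sub_le ?_ ?_) ?_) ?_) ?_) ?_
  · exact hE.trans (le_max_left _ _)
  · refine le_max_of_le_left (le_max_of_le_left ?_)
    rw [norm_mul, norm_pow, hxr]
    calc _ ≤ r ^ N * (r ^ N * ‖u‖) := by gcongr
      _ = _ := by ring
  · refine le_max_of_le_right (le_max_of_le_left ?_)
    rw [norm_mul, norm_mul, norm_mul, norm_pow, hxr, D.norm_a, D.norm_p, mul_one, ← pow_add]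
    exact mul_le_mul (D.pow_le_pow (by omega)) b2 (norm_nonneg _) (by positivity)
  · refine le_max_of_le_left (le_max_of_le_left ?_)
    rw [norm_mul, norm_mul, norm_mul, norm_mul, norm_pow, hxr, D.norm_a, D.norm_p, mul_one,
      ← pow_add, ← mul_assoc, ← pow_add]
    exact mul_le_mul_of_nonneg_right (D.pow_le_pow (by omega)) (norm_nonneg _)
  · refine le_max_of_le_right (le_max_of_le_right ?_)
    rw [norm_mul, norm_mul, norm_mul, norm_pow, norm_pow, hxr, D.norm_g, D.norm_p, mul_one,
      ← pow_mul, ← pow_add]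
    exact mul_le_mul (D.pow_le_pow (by omega)) b3 (norm_nonneg _) (by positivity)
  · refine le_max_of_le_left (le_max_of_le_right ?_)
    rw [norm_mul, D.norm_p]
    calc _ ≤ r ^ N * ‖(p : E) ^ 2 * g * x ^ (N - p - 1) * w‖ := by
          gcongr
          exact norm_natCast_mul_le _ _
      _ = r ^ (N + (N * 2 + (N - p - 1))) * ‖w‖ := by
          rw [norm_mul, norm_mul, norm_mul, norm_pow, norm_pow, hxr, D.norm_g, D.norm_p, mul_one,
            ← pow_mul, ← pow_add, ← mul_assoc, ← pow_add]
      _ ≤ _ := mul_le_mul_of_nonneg_right (D.pow_le_pow (by omega)) (norm_nonneg _)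

lemma norm_pow_sub_one_sub_pow_le (D : PolygonData p N r F a b g) {w : E} (hw : ‖w‖ ≤ 1) :
    ‖(1 + w) ^ p - 1 - w ^ p‖ ≤ r ^ N * ‖w‖ := by
  have := norm_add_pow_prime_sub_le D.prime (s := 1) (t := w) (by simp) hw
  rwa [one_pow, D.norm_p, ← sub_sub] at this

lemma norm_pow_sub_one_le (D : PolygonData p N r F a b g) {w : E} (hw : ‖w‖ ≤ 1) :
    ‖(1 + w) ^ p - 1‖ ≤ max (‖w‖ ^ p) (r ^ N * ‖w‖) := by
  rw [← sub_add_cancel ((1 + w) ^ p - 1) (w ^ p)]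
  exact ultra_add_le (le_max_of_le_right (D.norm_pow_sub_one_sub_pow_le hw))
    (le_max_of_le_left (norm_pow _ _).le)

lemma norm_pow_sub_one_eq (D : PolygonData p N r F a b g) {w : E} (hw : ‖w‖ ≤ 1)
    (h : r ^ N < ‖w‖ ^ (p - 1)) : ‖(1 + w) ^ p - 1‖ = ‖w‖ ^ p := by
  have hp := D.odd_prime
  have hw0 : 0 < ‖w‖ := by
    by_contra! h0
    rw [le_antisymm h0 (norm_nonneg _), zero_pow (by omega)] at h
    exact absurd h (pow_pos D.pos _).le.not_gt
  rw [← norm_pow]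
  refine IsUltrametricDist.norm_eq_of_add_norm_lt_max
    (x := (1 + w) ^ p - 1) (y := -w ^ p) (lt_max_of_lt_right ?_) |>.trans (norm_neg _)
  rw [← sub_eq_add_neg, norm_neg, norm_pow, ← pow_sub_one_mul (by omega : p ≠ 0) ‖w‖]
  exact (D.norm_pow_sub_one_sub_pow_le hw).trans_lt (mul_lt_mul_of_pos_right h hw0)

/-- Distinct roots are close: the first vertex of the polygon. -/
lemma norm_le_of_root (D : PolygonData p N r F a b g) {x w : E}
    (hx : monicValue F N x = 0) (hy : monicValue F N (x * (1 + w)) = 0) (hw : ‖w‖ ≤ 1) :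
    ‖w‖ ≤ r := by
  have hN := D.three_mul_le
  have hp := D.odd_prime
  have hr := D.pos
  by_contra! hlt
  have hP := D.norm_dominant_le hx hy hw
  obtain ⟨t1, t2, t3⟩ := D.norm_terms (D.norm_root_pow hx) ((1 + w) ^ p - 1) w
  have hu := D.norm_pow_sub_one_eq hw
    ((D.pow_le_pow (by omega : p - 1 ≤ N)).trans_lt (pow_lt_pow_left₀ hlt hr.le (by omega)))
  set u := (1 + w) ^ p - 1
  have hW : 0 < ‖w‖ := hr.trans hlt
  have hU : 0 < ‖u‖ := by rw [hu]; positivity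
  have hU1 : ‖u‖ ≤ 1 := by rw [hu]; exact pow_le_one₀ hW.le hw
  have f1 : r ^ (N - p) < ‖u‖ ^ (p - 1) := by
    rw [hu, ← pow_mul, Nat.mul_sub, mul_one, ← D.deg]
    exact pow_lt_pow_left₀ hlt hr.le (by omega)
  have f2 : r ^ (N - 1) < ‖w‖ ^ (N - 1) := pow_lt_pow_left₀ hlt hr.le (by omega)
  have s2 : r ^ (2 * N - p) * ‖u‖ < r ^ N * ‖u‖ ^ p := by
    rw [show 2 * N - p = N + (N - p) by omega, pow_add, mul_assoc,
      ← pow_sub_one_mul (by omega : p ≠ 0)]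
    gcongr
  have s3 : r ^ (3 * N - p - 1) * ‖w‖ < r ^ N * ‖u‖ ^ p := by
    rw [hu, ← pow_mul, ← D.deg, ← pow_sub_one_mul (by omega : N ≠ 0) ‖w‖]
    calc _ ≤ r ^ (N + (N - 1)) * ‖w‖ :=
          mul_le_mul_of_nonneg_right (D.pow_le_pow (by omega)) hW.le
      _ = r ^ N * (r ^ (N - 1) * ‖w‖) := by rw [pow_add, mul_assoc]
      _ < _ := by gcongr
  have hP' := hP.trans_lt (b := _) (c := r ^ N * ‖u‖ ^ p) (max_lt (max_lt
    (lt_of_le_of_lt (mul_le_mul_of_nonneg_right (D.pow_le_pow (by omega)) hU.le) s2)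
    (lt_of_le_of_lt (mul_le_mul_of_nonneg_right (D.pow_le_pow (by omega)) hW.le) s3)) (max_lt
    (lt_of_le_of_lt (mul_le_mul_of_nonneg_left (pow_le_of_le_one hU.le hU1 two_ne_zero)
      (by positivity)) s2)
    (lt_of_le_of_lt (mul_le_mul_of_nonneg_left (pow_le_of_le_one hW.le hw two_ne_zero)
      (by positivity)) s3)))
  rw [← t1] at hP' s2 s3
  rw [← t2] at s2
  rw [← t3] at s3
  have := ultra_add_lt (ultra_add_lt hP' s3) s2
  rw [sub_add_cancel, sub_add_cancel] at this
  exact lt_irrefl _ this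

/-- Roots closer than the first slope are at least as close as the second slope predicts. -/
lemma norm_le_pow_of_root (D : PolygonData p N r F a b g) {x w : E}
    (hx : monicValue F N x = 0) (hy : monicValue F N (x * (1 + w)) = 0) (hw : ‖w‖ < r) :
    ‖w‖ ≤ r ^ (p + 1) := by
  have hN := D.three_mul_le
  have hp := D.odd_prime
  have hr := D.pos
  have hr1 := D.lt_one
  by_contra! hlt
  have hw1 : ‖w‖ < 1 := hw.trans hr1
  have hP := D.norm_dominant_le hx hy hw1.le
  obtain ⟨t1, t2, t3⟩ := D.norm_terms (D.norm_root_pow hx) ((1 + w) ^ p - 1) w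
  have hexp : (p + 1) * (p - 1) = N - 1 := by
    rw [D.deg, ← Nat.sq_sub_sq p 1, one_pow, sq]
  have f2 : r ^ (N - 1) < ‖w‖ ^ (p - 1) := by
    rw [← hexp, pow_mul]
    exact pow_lt_pow_left₀ hlt (by positivity) (by omega)
  have hu := D.norm_pow_sub_one_eq hw1.le
    ((D.pow_le_pow (by omega : N - 1 ≤ N)).trans_lt f2)
  set u := (1 + w) ^ p - 1
  have hW : 0 < ‖w‖ := lt_trans (by positivity) hlt
  have hU : 0 < ‖u‖ := by rw [hu]; positivity
  have hU1 : ‖u‖ < 1 := by rw [hu]; exact pow_lt_one₀ hW.le hw1 (by omega)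
  have f1 : ‖u‖ ^ (p - 1) < r ^ (N - p) := by
    rw [hu, ← pow_mul, Nat.mul_sub, mul_one, ← D.deg]
    exact pow_lt_pow_left₀ hw hW.le (by omega)
  have s1 : r ^ N * ‖u‖ ^ p < r ^ (2 * N - p) * ‖u‖ := by
    rw [show 2 * N - p = N + (N - p) by omega, pow_add, mul_assoc,
      ← pow_sub_one_mul (by omega : p ≠ 0)]
    gcongr
  have s3 : r ^ (3 * N - p - 1) * ‖w‖ < r ^ (2 * N - p) * ‖u‖ := by
    rw [show 3 * N - p - 1 = (2 * N - p) + (N - 1) by omega, pow_add, mul_assoc, hu,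
      ← pow_sub_one_mul (by omega : p ≠ 0) ‖w‖]
    gcongr
  have hP' := hP.trans_lt (b := _) (c := r ^ (2 * N - p) * ‖u‖) (max_lt (max_lt
    (mul_lt_mul_of_pos_right (pow_lt_pow_right_of_lt_one₀ hr hr1 (by omega)) hU)
    (lt_of_le_of_lt (mul_le_mul_of_nonneg_right (D.pow_le_pow (by omega)) hW.le) s3)) (max_lt
    (mul_lt_mul_of_pos_left (pow_lt_self_of_lt_one₀ hU hU1 one_lt_two) (by positivity))
    (lt_of_le_of_lt (mul_le_mul_of_nonneg_left (pow_le_of_le_one hW.le hw1.le two_ne_zero)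
      (by positivity)) s3)))
  rw [← t2] at hP' s1 s3
  rw [← t1] at s1
  rw [← t3] at s3
  have := ultra_sub_lt s1 (ultra_add_lt hP' s3)
  rw [sub_add_cancel, sub_sub_cancel] at this
  exact lt_irrefl _ this

/-- There are no further roots beyond the second slope. -/
lemma eq_zero_of_root (D : PolygonData p N r F a b g) {x w : E}
    (hx : monicValue F N x = 0) (hy : monicValue F N (x * (1 + w)) = 0)
    (hw : ‖w‖ < r ^ (p + 1)) : w = 0 := by
  have hN := D.three_mul_le
  have hp := D.odd_prime
  have hr := D.pos
  have hr1 := D.lt_one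
  by_contra! hw0
  have hW : 0 < ‖w‖ := norm_pos_iff.2 hw0
  have hw1 : ‖w‖ < 1 := hw.trans_le (pow_le_one₀ hr.le hr1.le)
  have hwr : ‖w‖ ≤ r := hw.le.trans (pow_le_of_le_one hr.le hr1.le (by omega))
  have hP := D.norm_dominant_le hx hy hw1.le
  obtain ⟨t1, t2, t3⟩ := D.norm_terms (D.norm_root_pow hx) ((1 + w) ^ p - 1) w
  have hu := D.norm_pow_sub_one_le hw1.le
  set u := (1 + w) ^ p - 1
  have hexp : (p + 1) * (p - 1) = N - 1 := by
    rw [D.deg, ← Nat.sq_sub_sq p 1, one_pow, sq]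
  have f2 : ‖w‖ ^ (p - 1) < r ^ (N - 1) := by
    rw [← hexp, pow_mul]
    exact pow_lt_pow_left₀ hw hW.le (by omega)
  have hUr : ‖u‖ ≤ r ^ p := hu.trans (max_le (pow_le_pow_left₀ hW.le hwr p)
    ((mul_le_of_le_one_right (by positivity) hw1.le).trans (D.pow_le_pow (by omega))))
  have hU1 : ‖u‖ ≤ 1 := hUr.trans (pow_le_one₀ hr.le hr1.le)
  have hU := norm_nonneg u
  have s2 : r ^ (2 * N - p) * ‖u‖ < r ^ (3 * N - p - 1) * ‖w‖ := by
    calc _ ≤ r ^ (2 * N - p) * max (‖w‖ ^ p) (r ^ N * ‖w‖) := by gcongr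
      _ < _ := by
        rw [show 3 * N - p - 1 = (2 * N - p) + (N - 1) by omega, pow_add, mul_assoc]
        refine mul_lt_mul_of_pos_left (max_lt ?_ ?_) (by positivity)
        · rw [← pow_sub_one_mul (by omega : p ≠ 0)]
          gcongr
        · exact mul_lt_mul_of_pos_right (pow_lt_pow_right_of_lt_one₀ hr hr1 (by omega)) hW
  have s1 : r ^ N * ‖u‖ ^ p < r ^ (3 * N - p - 1) * ‖w‖ := by
    refine lt_of_le_of_lt ?_ s2
    rw [show 2 * N - p = N + (N - p) by omega, pow_add, mul_assoc,
      ← pow_sub_one_mul (by omega : p ≠ 0)]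
    gcongr
    rw [show N - p = p * (p - 1) by rw [D.deg, Nat.mul_sub, mul_one], pow_mul]
    gcongr
  have hP' := hP.trans_lt (b := _) (c := r ^ (3 * N - p - 1) * ‖w‖) (max_lt (max_lt
    (lt_of_le_of_lt (mul_le_mul_of_nonneg_right (D.pow_le_pow (by omega)) hU) s2)
    (mul_lt_mul_of_pos_right (pow_lt_pow_right_of_lt_one₀ hr hr1 (by omega)) hW)) (max_lt
    (lt_of_le_of_lt (mul_le_mul_of_nonneg_left (pow_le_of_le_one hU hU1 two_ne_zero)
      (by positivity)) s2)
    (mul_lt_mul_of_pos_left (pow_lt_self_of_lt_one₀ hW hw1 one_lt_two) (by positivity))))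
  rw [← t3] at hP' s1 s2
  rw [← t1] at s1
  rw [← t2] at s2
  have := ultra_sub_lt (ultra_sub_lt s1 s2) hP'
  rw [sub_sub_cancel] at this
  exact lt_irrefl _ this

/-- The residual equation of the first slope. -/
lemma norm_residual_first (D : PolygonData p N r F a b g) {x z : E}
    (hx : monicValue F N x = 0) (hy : monicValue F N (x * (1 + x * z)) = 0) (hz : ‖z‖ ≤ 1) :
    ‖b * z ^ (p * p) + a * z ^ p‖ < 1 := by
  have hN := D.three_mul_le
  have hp := D.odd_prime
  have hr := D.pos
  have hr1 := D.lt_one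
  have hxr := D.norm_root_pow hx
  have hwr : ‖x * z‖ ≤ r := by
    rw [norm_mul, hxr]; exact mul_le_of_le_one_right hr.le hz
  have hw1 : ‖x * z‖ ≤ 1 := hwr.trans hr1.le
  have hP := D.norm_dominant_le hx hy hw1
  obtain ⟨-, -, t3⟩ := D.norm_terms hxr ((1 + x * z) ^ p - 1) (x * z)
  have hu := D.norm_pow_sub_one_le hw1
  have hd := D.norm_pow_sub_one_sub_pow_le hw1
  have hxp := D.norm_pow_add_le (hxr.le.trans hr1.le) hx
  rw [hxr] at hxp
  generalize hwdef : x * z = w at *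
  set u := (1 + w) ^ p - 1
  have hUr : ‖u‖ ≤ r ^ p := hu.trans (max_le (pow_le_pow_left₀ (norm_nonneg _) hwr p)
    ((mul_le_of_le_one_right (by positivity) hw1).trans (D.pow_le_pow (by omega))))
  have hU1 : ‖u‖ ≤ 1 := hUr.trans (pow_le_one₀ hr.le hr1.le)
  have hd' : ‖u - w ^ p‖ ≤ r ^ (N + 1) := by
    rw [pow_succ]
    exact hd.trans (by gcongr)
  have hPb : ‖x ^ N * u ^ p - p * a * x ^ (N - p) * u - p ^ 2 * g * x ^ (N - p - 1) * w‖
      ≤ r ^ (2 * N + 1) := by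
    refine hP.trans (max_le (max_le ?_ ?_) (max_le ?_ ?_))
    · calc _ ≤ r ^ (2 * N) * r ^ p := by gcongr
        _ ≤ _ := by rw [← pow_add]; exact D.pow_le_pow (by omega)
    · calc _ ≤ r ^ (3 * N - p + 1) * 1 := by gcongr
        _ ≤ _ := by rw [mul_one]; exact D.pow_le_pow (by omega)
    · calc _ ≤ r ^ (2 * N - p) * (r ^ p) ^ 2 := by gcongr
        _ ≤ _ := by rw [← pow_mul, ← pow_add]; exact D.pow_le_pow (by omega)
    · calc _ ≤ r ^ (3 * N - p - 1) * r ^ 2 := by gcongr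
        _ ≤ _ := by rw [← pow_add]; exact D.pow_le_pow (by omega)
  have hQ : ‖x ^ (2 * N) * z ^ (p * p) - p * a * x ^ N * z ^ p‖ ≤ r ^ (2 * N + 1) := by
    have e1 : x ^ N * (w ^ p) ^ p = x ^ (2 * N) * z ^ (p * p) := by
      rw [← hwdef, ← pow_mul, mul_pow, ← D.deg]; ring
    have e2 : x ^ (N - p) * w ^ p = x ^ N * z ^ p := by
      rw [← hwdef, mul_pow, ← mul_assoc, ← pow_add, Nat.sub_add_cancel (by omega)]
    have : x ^ (2 * N) * z ^ (p * p) - p * a * x ^ N * z ^ p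
        = (x ^ N * u ^ p - p * a * x ^ (N - p) * u - p ^ 2 * g * x ^ (N - p - 1) * w)
        - x ^ N * (u ^ p - (w ^ p) ^ p) + p * a * x ^ (N - p) * (u - w ^ p)
        + p ^ 2 * g * x ^ (N - p - 1) * w := by
      linear_combination -e1 + p * a * e2
    rw [this]
    refine ultra_add_le (ultra_add_le (ultra_sub_le hPb ?_) ?_) ?_
    · rw [norm_mul, norm_pow, hxr]
      calc _ ≤ r ^ N * r ^ (N + 1) := by
            gcongr
            refine (norm_pow_sub_pow_le hU1 ?_ p).trans hd'
            rw [norm_pow]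
            exact pow_le_one₀ (norm_nonneg _) hw1
        _ ≤ _ := by rw [← pow_add]; exact D.pow_le_pow (by omega)
    · rw [(D.norm_terms hxr (u - w ^ p) 0).2.1]
      calc _ ≤ r ^ (2 * N - p) * r ^ (N + 1) := by gcongr
        _ ≤ _ := by rw [← pow_add]; exact D.pow_le_pow (by omega)
    · rw [t3]
      calc _ ≤ r ^ (3 * N - p - 1) * r := by gcongr
        _ ≤ _ := by rw [← pow_succ]; exact D.pow_le_pow (by omega)
  have hfin : ‖x ^ (2 * N) * (b * z ^ (p * p) + a * z ^ p)‖ ≤ r ^ (2 * N + 1) := by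
    have : x ^ (2 * N) * (b * z ^ (p * p) + a * z ^ p)
        = b * (x ^ (2 * N) * z ^ (p * p) - p * a * x ^ N * z ^ p)
          + (x ^ N + p * b) * (a * x ^ N * z ^ p) := by ring
    rw [this]
    refine ultra_add_le (by rwa [norm_mul, D.norm_b, one_mul]) ?_
    rw [norm_mul, norm_mul, norm_mul, norm_pow, norm_pow, D.norm_a, hxr, one_mul]
    calc _ ≤ r ^ N * r * (r ^ N * 1) := by
          gcongr
          exact pow_le_one₀ (norm_nonneg _) hz
      _ = _ := by ring
  rw [norm_mul, norm_pow, hxr, pow_succ] at hfin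
  exact (le_of_mul_le_mul_left hfin (by positivity)).trans_lt hr1

/-- The residual equation of the second slope. -/
lemma norm_residual_second (D : PolygonData p N r F a b g) {x z : E}
    (hx : monicValue F N x = 0) (hy : monicValue F N (x * (1 + x ^ (p + 1) * z)) = 0)
    (hz : ‖z‖ ≤ 1) : ‖a * b * z ^ p - g * z‖ < 1 := by
  have hN := D.three_mul_le
  have hp := D.odd_prime
  have hr := D.pos
  have hr1 := D.lt_one
  have hxr := D.norm_root_pow hx
  have hwr : ‖x ^ (p + 1) * z‖ ≤ r ^ (p + 1) := by
    rw [norm_mul, norm_pow, hxr]; exact mul_le_of_le_one_right (by positivity) hz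
  have hw1 : ‖x ^ (p + 1) * z‖ ≤ 1 := hwr.trans (pow_le_one₀ hr.le hr1.le)
  have hP := D.norm_dominant_le hx hy hw1
  have hu := D.norm_pow_sub_one_le hw1
  have hd := D.norm_pow_sub_one_sub_pow_le hw1
  have hxp := D.norm_pow_add_le (hxr.le.trans hr1.le) hx
  rw [hxr] at hxp
  have hexp : (p + 1) * p = N + p := by rw [D.deg]; ring
  generalize hwdef : x ^ (p + 1) * z = w at *
  set u := (1 + w) ^ p - 1
  have hUr : ‖u‖ ≤ r ^ (N + p) := by
    refine hu.trans (max_le ?_ ?_)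
    · rw [← hexp, pow_mul]
      gcongr
    · calc _ ≤ r ^ N * r ^ (p + 1) := by gcongr
        _ ≤ _ := by rw [← pow_add]; exact D.pow_le_pow (by omega)
  have hd' : ‖u - w ^ p‖ ≤ r ^ (N + (p + 1)) := by
    rw [pow_add]
    exact hd.trans (by gcongr)
  have hPb : ‖x ^ N * u ^ p - p * a * x ^ (N - p) * u - p ^ 2 * g * x ^ (N - p - 1) * w‖
      ≤ r ^ (3 * N + 1) := by
    refine hP.trans (max_le (max_le ?_ ?_) (max_le ?_ ?_))
    · calc _ ≤ r ^ (2 * N) * r ^ (N + p) := by gcongr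
        _ ≤ _ := by rw [← pow_add]; exact D.pow_le_pow (by omega)
    · calc _ ≤ r ^ (3 * N - p + 1) * r ^ (p + 1) := by gcongr
        _ ≤ _ := by rw [← pow_add]; exact D.pow_le_pow (by omega)
    · calc _ ≤ r ^ (2 * N - p) * (r ^ (N + p)) ^ 2 := by gcongr
        _ ≤ _ := by rw [← pow_mul, ← pow_add]; exact D.pow_le_pow (by omega)
    · calc _ ≤ r ^ (3 * N - p - 1) * (r ^ (p + 1)) ^ 2 := by gcongr
        _ ≤ _ := by rw [← pow_mul, ← pow_add]; exact D.pow_le_pow (by omega)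
  have hQ : ‖p * a * x ^ (2 * N) * z ^ p + p ^ 2 * g * x ^ N * z‖ ≤ r ^ (3 * N + 1) := by
    have e1 : x ^ (N - p) * w ^ p = x ^ (2 * N) * z ^ p := by
      rw [← hwdef, mul_pow, ← mul_assoc, ← pow_mul, hexp, ← pow_add]
      congr 2
      omega
    have e2 : x ^ (N - p - 1) * w = x ^ N * z := by
      rw [← hwdef, ← mul_assoc, ← pow_add]
      congr 2
      omega
    have : p * a * x ^ (2 * N) * z ^ p + p ^ 2 * g * x ^ N * z
        = x ^ N * u ^ p
        - (x ^ N * u ^ p - p * a * x ^ (N - p) * u - p ^ 2 * g * x ^ (N - p - 1) * w)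
        - p * a * x ^ (N - p) * (u - w ^ p) := by
      linear_combination -(p * a) * e1 - (p ^ 2 * g) * e2
    rw [this]
    refine ultra_sub_le (ultra_sub_le ?_ hPb) ?_
    · rw [norm_mul, norm_pow, norm_pow, hxr]
      calc _ ≤ r ^ N * (r ^ (N + p)) ^ p := by gcongr
        _ ≤ _ := by
          rw [← pow_mul, ← pow_add]
          refine D.pow_le_pow ?_
          nlinarith
    · rw [(D.norm_terms hxr (u - w ^ p) 0).2.1]
      calc _ ≤ r ^ (2 * N - p) * r ^ (N + (p + 1)) := by gcongr
        _ ≤ _ := by rw [← pow_add]; exact D.pow_le_pow (by omega)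
  have hfin : ‖p ^ 2 * x ^ N * (a * b * z ^ p - g * z)‖ ≤ r ^ (3 * N + 1) := by
    have : p ^ 2 * x ^ N * (a * b * z ^ p - g * z)
        = p * x ^ N * a * z ^ p * (x ^ N + p * b)
          - (p * a * x ^ (2 * N) * z ^ p + p ^ 2 * g * x ^ N * z) := by ring
    rw [this]
    refine ultra_sub_le ?_ hQ
    rw [norm_mul, norm_mul, norm_mul, norm_mul, norm_pow, norm_pow, D.norm_a, D.norm_p, hxr,
      mul_one]
    calc _ ≤ r ^ N * r ^ N * 1 * (r ^ N * r) := by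
          gcongr
          exact pow_le_one₀ (norm_nonneg _) hz
      _ = _ := by ring
  rw [norm_mul, norm_mul, norm_pow, norm_pow, D.norm_p, hxr,
    show r ^ (3 * N + 1) = (r ^ N) ^ 2 * r ^ N * r by ring] at hfin
  exact (le_of_mul_le_mul_left hfin (by positivity)).trans_lt hr1

end PolygonData

end Polygon

section Action

variable {E K : Type*} [NormedField E] [IsUltrametricDist E] [Field K] [Algebra K E]

lemma norm_iterate_sub_lt {σ : E ≃ₐ[K] E} (hσ : ∀ z, ‖σ z‖ = ‖z‖) {x e : E} (he : σ e = e)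
    (he1 : ‖e‖ ≤ 1) {m : ℕ} (hm : 2 ≤ m) (hx0 : 0 < ‖x‖) (hx1 : ‖x‖ < 1)
    (h : ‖σ x - x - e * x ^ m‖ < ‖x‖ ^ m) (n : ℕ) :
    ‖(σ ^ n) x - x - n * e * x ^ m‖ < ‖x‖ ^ m := by
  have hxm : 0 < ‖x‖ ^ m := by positivity
  have hx : x ≠ 0 := norm_pos_iff.1 hx0
  have hex : ‖e * x ^ m‖ ≤ ‖x‖ ^ m := by
    rw [norm_mul, norm_pow]
    exact mul_le_of_le_one_left hxm.le he1
  have h1 : ‖σ x - x‖ < ‖x‖ := by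
    rw [← sub_add_cancel (σ x - x) (e * x ^ m)]
    exact (ultra_add_le h.le hex).trans_lt (pow_lt_self_of_lt_one₀ hx0 hx1 (by omega))
  have h2 : ‖σ x ^ m - x ^ m‖ < ‖x‖ ^ m := by
    have hw : ‖(σ x - x) / x‖ < 1 := by rwa [norm_div, div_lt_one hx0]
    have : σ x ^ m - x ^ m = x ^ m * ((1 + (σ x - x) / x) ^ m - 1) := by
      rw [mul_sub, ← mul_pow, mul_add, mul_div_cancel₀ _ hx]
      ring
    rw [this, norm_mul, norm_pow]
    exact mul_lt_of_lt_one_right hxm ((norm_one_add_pow_sub_one_le hw.le m).trans_lt hw)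
  induction n with
  | zero => simpa using hxm
  | succ n ih =>
    have : (σ ^ (n + 1)) x - x - (n + 1 : ℕ) * e * x ^ m
        = σ ((σ ^ n) x - x - n * e * x ^ m) + (σ x - x - e * x ^ m)
          + n * (e * (σ x ^ m - x ^ m)) := by
      rw [pow_succ', AlgEquiv.mul_apply]
      simp only [map_sub, map_mul, map_pow, map_natCast, he]
      push_cast
      ring
    rw [this]
    refine ultra_add_lt (ultra_add_lt (by rwa [hσ]) h)
      ((norm_natCast_mul_le _ _).trans_lt ?_)
    rw [norm_mul]
    exact (mul_le_of_le_one_left (norm_nonneg _) he1).trans_lt h2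

/-- If `σ` moves `x` by about `j * c * x ^ m`, then its `p`-th power moves `x` by less. -/
lemma norm_pow_prime_sub_lt {p : ℕ} (hpE : ‖(p : E)‖ < 1) {σ : E ≃ₐ[K] E}
    (hσ : ∀ z, ‖σ z‖ = ‖z‖) {x z c : E} (hc : σ c = c) (hc1 : ‖c‖ ≤ 1) {m j : ℕ} (hm : 2 ≤ m)
    (hx0 : 0 < ‖x‖) (hx1 : ‖x‖ < 1) (hz : σ x = x + x ^ m * z) (h : ‖z - j * c‖ < 1) :
    ‖(σ ^ p) x - x‖ < ‖x‖ ^ m := by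
  have hxm : 0 < ‖x‖ ^ m := by positivity
  have hjc : ‖(j : E) * c‖ ≤ 1 := (norm_natCast_mul_le _ _).trans hc1
  have h1 : ‖σ x - x - j * c * x ^ m‖ < ‖x‖ ^ m := by
    have : σ x - x - j * c * x ^ m = x ^ m * (z - j * c) := by rw [hz]; ring
    rw [this, norm_mul, norm_pow]
    exact mul_lt_of_lt_one_right hxm h
  have h2 := norm_iterate_sub_lt hσ (by rw [map_mul, map_natCast, hc]) hjc hm hx0 hx1 h1 p
  rw [← sub_add_cancel ((σ ^ p) x - x) (p * (j * c) * x ^ m)]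
  refine ultra_add_lt h2 ?_
  rw [norm_mul, norm_mul, norm_pow]
  exact mul_lt_of_lt_one_left hxm
    ((mul_le_of_le_one_right (norm_nonneg _) hjc).trans_lt hpE)

namespace PolygonData

variable {p N : ℕ} {r : ℝ} {F : ℕ → E} {a b g : E}

lemma norm_pow_sub_lt_sq (D : PolygonData p N r F a b g) {σ : E ≃ₐ[K] E}
    (hσ : ∀ z, ‖σ z‖ = ‖z‖) {x c : E} (hx : monicValue F N x = 0)
    (hy : monicValue F N (σ x) = 0) (hc : σ c = c) (hc1 : ‖c‖ ≤ 1)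
    (hca : ‖b * c ^ (p * (p - 1)) + a‖ < 1) : ‖(σ ^ p) x - x‖ < ‖x‖ ^ 2 := by
  have hxr := D.norm_root_pow hx
  have hx0 : 0 < ‖x‖ := hxr ▸ D.pos
  have hx1 : ‖x‖ < 1 := hxr ▸ D.lt_one
  have hxne : x ≠ 0 := norm_pos_iff.1 hx0
  have := Fact.mk D.prime
  set w := (σ x - x) / x with hw
  have hxw : x * (1 + w) = σ x := by
    rw [hw, mul_add, mul_div_cancel₀ _ hxne]
    ring
  have hw1 : ‖w‖ ≤ 1 := by
    rw [hw, norm_div, div_le_one hx0]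
    exact ultra_sub_le (hσ x).le le_rfl
  rw [← hxw] at hy
  have hwr := D.norm_le_of_root hx hy hw1
  set z := w / x with hz
  have hxz : x * z = w := mul_div_cancel₀ _ hxne
  have hz1 : ‖z‖ ≤ 1 := by
    rwa [hz, norm_div, div_le_one hx0, hxr]
  rw [← hxz] at hy
  have hres := D.norm_residual_first hx hy hz1
  have h1 : ‖(z ^ p) ^ p - (c ^ (p - 1) * z) ^ p‖ < 1 := by
    have : b * ((z ^ p) ^ p - (c ^ (p - 1) * z) ^ p)
        = (b * z ^ (p * p) + a * z ^ p) - (b * c ^ (p * (p - 1)) + a) * z ^ p := by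
      rw [mul_pow, ← pow_mul, ← pow_mul, mul_comm (p - 1)]
      ring
    have hu : ‖(z ^ p) ^ p - (c ^ (p - 1) * z) ^ p‖
        = ‖b * ((z ^ p) ^ p - (c ^ (p - 1) * z) ^ p)‖ := by rw [norm_mul, D.norm_b, one_mul]
    rw [hu, this]
    refine ultra_sub_lt hres ?_
    rw [norm_mul, norm_pow]
    exact (mul_le_of_le_one_right (norm_nonneg _)
      (pow_le_one₀ (norm_nonneg _) hz1)).trans_lt hca
  have h2 : ‖z ^ p - c ^ (p - 1) * z‖ < 1 := by
    refine norm_lt_one_of_pow_sub_lt D.prime D.norm_p_lt_one ?_ ?_ h1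
    · rw [norm_pow]
      exact pow_le_one₀ (norm_nonneg _) hz1
    · rw [norm_mul, norm_pow]
      exact mul_le_one₀ (pow_le_one₀ (norm_nonneg _) hc1) (norm_nonneg _) hz1
  obtain ⟨j, hj⟩ := exists_norm_sub_natCast_mul_lt D.norm_p_lt_one hz1 hc1 h2
  refine norm_pow_prime_sub_lt D.norm_p_lt_one hσ hc hc1 le_rfl hx0 hx1 ?_ hj
  rw [← hxw, ← hxz]
  ring

/-- The shape of a root `y` close to a given root `x`. -/
lemma exists_eq_add_of_norm_sub_lt (D : PolygonData p N r F a b g) {x y : E}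
    (hx : monicValue F N x = 0) (hy : monicValue F N y = 0) (h : ‖y - x‖ < ‖x‖ ^ 2) :
    ∃ z, ‖z‖ ≤ 1 ∧ y = x + x ^ (p + 2) * z ∧ ‖a * b * z ^ p - g * z‖ < 1 := by
  have hxr := D.norm_root_pow hx
  have hx0 : 0 < ‖x‖ := hxr ▸ D.pos
  have hxne : x ≠ 0 := norm_pos_iff.1 hx0
  set w := (y - x) / x with hw
  have hxw : x * (1 + w) = y := by
    rw [hw, mul_add, mul_div_cancel₀ _ hxne]
    ring
  have hw1 : ‖w‖ < r := by
    rwa [hw, norm_div, div_lt_iff₀ hx0, ← hxr, ← sq]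
  rw [← hxw] at hy
  have hwr := D.norm_le_pow_of_root hx hy hw1
  set z := w / x ^ (p + 1) with hz
  have hxz : x ^ (p + 1) * z = w := mul_div_cancel₀ _ (pow_ne_zero _ hxne)
  have hz1 : ‖z‖ ≤ 1 := by
    rwa [hz, norm_div, norm_pow, div_le_one (by positivity), hxr]
  rw [← hxz] at hy
  refine ⟨z, hz1, ?_, D.norm_residual_second hx hy hz1⟩
  rw [← hxw, ← hxz]
  ring

lemma eq_of_norm_sub_lt (D : PolygonData p N r F a b g) {x y : E}
    (hx : monicValue F N x = 0) (hy : monicValue F N y = 0) (h : ‖y - x‖ < ‖x‖ ^ (p + 2)) :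
    y = x := by
  have hxr := D.norm_root_pow hx
  have hx0 : 0 < ‖x‖ := hxr ▸ D.pos
  have hxne : x ≠ 0 := norm_pos_iff.1 hx0
  set w := (y - x) / x with hw
  have hxw : x * (1 + w) = y := by
    rw [hw, mul_add, mul_div_cancel₀ _ hxne]
    ring
  have hw1 : ‖w‖ < r ^ (p + 1) := by
    rwa [hw, norm_div, div_lt_iff₀ hx0, ← hxr, ← pow_succ]
  rw [← hxw] at hy
  have := D.eq_zero_of_root hx hy hw1
  rw [← hxw, this, add_zero, mul_one]

lemma pow_apply_eq_self (D : PolygonData p N r F a b g) {τ : E ≃ₐ[K] E}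
    (hτ : ∀ z, ‖τ z‖ = ‖z‖) {x c : E} (hx : ∀ n : ℕ, monicValue F N ((τ ^ n) x) = 0)
    (hc : τ c = c) (hc1 : ‖c‖ ≤ 1) (hcg : ‖a * b * c ^ (p - 1) - g‖ < 1)
    (h : ‖τ x - x‖ < ‖x‖ ^ 2) : (τ ^ p) x = x := by
  have hx' : monicValue F N x = 0 := hx 0
  have hxr := D.norm_root_pow hx'
  have hx0 : 0 < ‖x‖ := hxr ▸ D.pos
  have hx1 : ‖x‖ < 1 := hxr ▸ D.lt_one
  have := Fact.mk D.prime
  obtain ⟨z, hz1, hz, hres⟩ := D.exists_eq_add_of_norm_sub_lt hx' (pow_one τ ▸ hx 1) h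
  have h2 : ‖z ^ p - c ^ (p - 1) * z‖ < 1 := by
    have : a * b * (z ^ p - c ^ (p - 1) * z)
        = (a * b * z ^ p - g * z) - (a * b * c ^ (p - 1) - g) * z := by ring
    have hu : ‖z ^ p - c ^ (p - 1) * z‖ = ‖a * b * (z ^ p - c ^ (p - 1) * z)‖ := by
      rw [norm_mul, norm_mul, D.norm_a, D.norm_b, one_mul, one_mul]
    rw [hu, this]
    refine ultra_sub_lt hres ?_
    rw [norm_mul]
    exact (mul_le_of_le_one_right (norm_nonneg _) hz1).trans_lt hcg
  obtain ⟨j, hj⟩ := exists_norm_sub_natCast_mul_lt D.norm_p_lt_one hz1 hc1 h2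
  exact D.eq_of_norm_sub_lt hx' (hx p)
    (norm_pow_prime_sub_lt D.norm_p_lt_one hτ hc hc1 (by omega) hx0 hx1 hz hj)

lemma pow_sq_apply_eq_self (D : PolygonData p N r F a b g) {σ : E ≃ₐ[K] E}
    (hσ : ∀ n : ℕ, ∀ z, ‖(σ ^ n) z‖ = ‖z‖) {x c d : E}
    (hx : ∀ n : ℕ, monicValue F N ((σ ^ n) x) = 0)
    (hc : σ c = c) (hc1 : ‖c‖ ≤ 1) (hca : ‖b * c ^ (p * (p - 1)) + a‖ < 1)
    (hd : σ d = d) (hd1 : ‖d‖ ≤ 1) (hdg : ‖a * b * d ^ (p - 1) - g‖ < 1) :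
    (σ ^ p ^ 2) x = x := by
  have h := D.norm_pow_sub_lt_sq (by simpa using hσ 1) (hx 0) (by simpa using hx 1) hc hc1 hca
  rw [sq, pow_mul]
  refine D.pow_apply_eq_self (hσ p) (fun n => ?_) ?_ hd1 hdg h
  · rw [← pow_mul]
    exact hx _
  · rw [AlgEquiv.coe_pow]
    exact Function.IsFixedPt.iterate hd p

end PolygonData

end Action

section MonicPolynomial

variable {R : Type*} [CommRing R]

/-- The monic polynomial of degree `n` with lower coefficients `F 1, …, F n`. -/
noncomputable def monicPolynomial (F : ℕ → R) (n : ℕ) : R[X] :=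
  X ^ n + ∑ i ∈ Finset.range n, C (F (i + 1)) * X ^ (n - (i + 1))

lemma monicPolynomial_degree_lt (F : ℕ → R) (n : ℕ) :
    (∑ i ∈ Finset.range n, C (F (i + 1)) * X ^ (n - (i + 1))).degree < (n : WithBot ℕ) := by
  refine (degree_sum_le _ _).trans_lt ((Finset.sup_lt_iff (WithBot.bot_lt_coe n)).2 fun i hi => ?_)
  rw [Finset.mem_range] at hi
  exact (degree_C_mul_X_pow_le _ _).trans_lt (Nat.cast_lt.2 (by omega))

lemma monic_monicPolynomial (F : ℕ → R) (n : ℕ) : (monicPolynomial F n).Monic :=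
  monic_X_pow_add (monicPolynomial_degree_lt F n)

lemma natDegree_monicPolynomial [Nontrivial R] (F : ℕ → R) (n : ℕ) :
    (monicPolynomial F n).natDegree = n := by
  refine natDegree_eq_of_degree_eq_some ?_
  rw [monicPolynomial, degree_add_eq_left_of_degree_lt, degree_X_pow]
  rw [degree_X_pow]
  exact monicPolynomial_degree_lt F n

lemma map_monicPolynomial {S : Type*} [CommRing S] (φ : R →+* S) (F : ℕ → R) (n : ℕ) :
    (monicPolynomial F n).map φ = monicPolynomial (fun i => φ (F i)) n := by
  simp [monicPolynomial, Polynomial.map_sum]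

end MonicPolynomial

lemma eval_monicPolynomial {E : Type*} [NormedField E] (F : ℕ → E) (n : ℕ) (x : E) :
    (monicPolynomial F n).eval x = monicValue F n x := by
  simp [monicPolynomial, monicValue, eval_finsetSum]

lemma pow_card_le_norm_prod {E : Type*} [NormedField E] {B : ℝ} (hB : 0 ≤ B) (s : Multiset E)
    (h : ∀ y ∈ s, B ≤ ‖y‖) : B ^ s.card ≤ ‖s.prod‖ := by
  induction s using Multiset.induction_on with
  | empty => simp
  | cons y s ih =>
    rw [Multiset.card_cons, Multiset.prod_cons, norm_mul, pow_succ']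
    exact mul_le_mul (h y (Multiset.mem_cons_self y s))
      (ih fun z hz => h z (Multiset.mem_cons_of_mem hz)) (by positivity) (norm_nonneg _)

section Converse

variable {E K : Type*} [NormedField E] [IsUltrametricDist E] [Field K] [Algebra K E]

/-- An automorphism of `p`-power order fixes the residue class of a solution of the second residual
equation. -/
lemma norm_apply_sub_lt_one {p : ℕ} [Fact p.Prime] (hpE : ‖(p : E)‖ < 1) {σ : E ≃ₐ[K] E}
    (hσ : ∀ z, ‖σ z‖ = ‖z‖) {e g z : E} (he : σ e = e) (hg : σ g = g) (he1 : ‖e‖ = 1)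
    (hz : ‖z‖ = 1) (h : ‖e * z ^ p - g * z‖ < 1) {k : ℕ} (hk : σ ^ p ^ k = 1) :
    ‖σ z - z‖ < 1 := by
  have hp0 : p ≠ 0 := (Fact.out : p.Prime).ne_zero
  have hσz : ‖σ z‖ = 1 := (hσ z).trans hz
  have h1 : ‖e * z ^ (p - 1) - g‖ < 1 := by
    have : (e * z ^ (p - 1) - g) * z = e * z ^ p - g * z := by
      rw [sub_mul, mul_assoc, pow_sub_one_mul hp0]
    rwa [← mul_one ‖_‖, ← hz, ← norm_mul, this, hz]
  have h2 : ‖e * σ z ^ p - g * σ z‖ < 1 := by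
    rwa [← hσ, map_sub, map_mul, map_mul, map_pow, he, hg] at h
  have h3 : ‖σ z ^ p - z ^ (p - 1) * σ z‖ < 1 := by
    have hu : ‖σ z ^ p - z ^ (p - 1) * σ z‖ = ‖e * (σ z ^ p - z ^ (p - 1) * σ z)‖ := by
      rw [norm_mul, he1, one_mul]
    have : e * (σ z ^ p - z ^ (p - 1) * σ z)
        = (e * σ z ^ p - g * σ z) - (e * z ^ (p - 1) - g) * σ z := by ring
    rw [hu, this]
    refine ultra_sub_lt h2 ?_
    rwa [norm_mul, hσz, mul_one]
  obtain ⟨j, hj⟩ := exists_norm_sub_natCast_mul_lt hpE hσz.le hz.le h3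
  have hiter (n : ℕ) : ‖(σ ^ n) z - (j : E) ^ n * z‖ < 1 := by
    induction n with
    | zero => simp
    | succ n ih =>
      have : (σ ^ (n + 1)) z - (j : E) ^ (n + 1) * z
          = σ ((σ ^ n) z - (j : E) ^ n * z) + ((j ^ n : ℕ) : E) * (σ z - j * z) := by
        rw [pow_succ', AlgEquiv.mul_apply]
        simp only [map_sub, map_mul, map_pow, map_natCast]
        push_cast
        ring
      rw [this]
      exact ultra_add_lt (by rwa [hσ]) ((norm_natCast_mul_le _ _).trans_lt hj)
  have h4 := hiter (p ^ k)
  rw [hk, AlgEquiv.one_apply] at h4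
  have h5 : ‖(1 : E) - j‖ < 1 := by
    refine norm_lt_one_of_pow_pow_sub_lt Fact.out hpE (by simp)
      (IsUltrametricDist.norm_natCast_le_one E j) k ?_
    have : ((1 : E) ^ p ^ k - (j : E) ^ p ^ k) * z = z - (j : E) ^ p ^ k * z := by ring
    rwa [← mul_one ‖_‖, ← hz, ← norm_mul, this, hz]
  have : σ z - z = (σ z - j * z) - (1 - j) * z := by ring
  rw [this]
  refine ultra_sub_lt hj ?_
  rwa [norm_mul, hz, mul_one]

lemma norm_prod_sub_pow_card_lt {ι : Type*} (s : Finset ι) (v : ι → E) {z : E} (hz : ‖z‖ = 1)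
    (h : ∀ i ∈ s, ‖v i - z‖ < 1) : ‖∏ i ∈ s, v i - z ^ s.card‖ < 1 := by
  classical
  induction s using Finset.induction_on with
  | empty => simp
  | insert i s hi ih =>
    have hvi := h i (Finset.mem_insert_self i s)
    have hs := ih fun j hj => h j (Finset.mem_insert_of_mem hj)
    have hvi1 : ‖v i‖ ≤ 1 := by
      rw [← sub_add_cancel (v i) z]
      exact ultra_add_le hvi.le hz.le
    rw [Finset.prod_insert hi, Finset.card_insert_of_notMem hi]
    have : v i * ∏ j ∈ s, v j - z ^ (s.card + 1)
        = v i * (∏ j ∈ s, v j - z ^ s.card) + (v i - z) * z ^ s.card := by ring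
    rw [this]
    refine ultra_add_lt ?_ ?_
    · rw [norm_mul]
      exact (mul_le_of_le_one_left (norm_nonneg _) hvi1).trans_lt hs
    · rwa [norm_mul, norm_pow, hz, one_pow, mul_one]

/-- If the Galois group is a `p`-group and `K` has perfect residue field, the residue class of `z`
is represented by an element of `K`. -/
lemma exists_norm_algebraMap_sub_lt_one {p : ℕ} [Fact p.Prime] [FiniteDimensional K E]
    [IsGalois K E] (hpE : ‖(p : E)‖ < 1) (hG : IsPGroup p (E ≃ₐ[K] E))
    (hperf : ∀ n : K, ‖algebraMap K E n‖ ≤ 1 → ∀ k : ℕ, ∃ c : K, ‖algebraMap K E c‖ ≤ 1 ∧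
      ‖algebraMap K E c ^ p ^ k - algebraMap K E n‖ < 1)
    {z : E} (hz : ‖z‖ = 1) (h : ∀ σ : E ≃ₐ[K] E, ‖σ z - z‖ < 1) :
    ∃ c : K, ‖algebraMap K E c - z‖ < 1 := by
  obtain ⟨k, hk⟩ := IsPGroup.iff_card.1 hG
  rw [Nat.card_eq_fintype_card] at hk
  have hprod := norm_prod_sub_pow_card_lt Finset.univ (fun σ : E ≃ₐ[K] E => σ z) hz
    fun σ _ => h σ
  rw [Finset.card_univ, hk, ← Algebra.norm_eq_prod_automorphisms] at hprod
  have hn : ‖algebraMap K E (Algebra.norm K z)‖ ≤ 1 := by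
    rw [← sub_add_cancel (algebraMap K E (Algebra.norm K z)) (z ^ p ^ k)]
    exact ultra_add_le hprod.le (by rw [norm_pow, hz, one_pow])
  obtain ⟨c, hc1, hc⟩ := hperf _ hn k
  refine ⟨c, norm_lt_one_of_pow_pow_sub_lt Fact.out hpE hc1 hz.le k ?_⟩
  rw [← sub_add_sub_cancel _ (algebraMap K E (Algebra.norm K z))]
  exact ultra_add_lt hc hprod

namespace PolygonData

variable {p N : ℕ} {r : ℝ} {F : ℕ → E} {a b g : E}

/-- Every root has another root close to it. -/
lemma exists_root_norm_sub_lt (D : PolygonData p N r F a b g)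
    (hsplit : (monicPolynomial F N).Splits) (hsep : (monicPolynomial F N).Separable) {x : E}
    (hx : monicValue F N x = 0) :
    ∃ y, monicValue F N y = 0 ∧ y ≠ x ∧ ‖y - x‖ < ‖x‖ ^ 2 := by
  classical
  have hN := D.three_mul_le
  have hp := D.odd_prime
  have hr := D.pos
  have hxr := D.norm_root_pow hx
  have hne := (monic_monicPolynomial F N).ne_zero
  have hxroot : x ∈ (monicPolynomial F N).roots := by
    rw [mem_roots hne, IsRoot, eval_monicPolynomial, hx]
  have hcard : (monicPolynomial F N).roots.card = N := by
    rw [← hsplit.natDegree_eq_card_roots, natDegree_monicPolynomial]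
  have hnodup := nodup_roots hsep
  have hder : ‖x * (derivative (monicPolynomial F N)).eval x‖ ≤ r ^ (2 * N) := by
    have hm (m : ℕ) : x * (m * x ^ (m - 1)) = m * x ^ m := by
      cases m with
      | zero => simp
      | succ m => rw [Nat.add_sub_cancel]; ring
    have hxm (m : ℕ) : ‖x ^ m‖ ≤ 1 := by
      rw [norm_pow, hxr]
      exact pow_le_one₀ hr.le D.lt_one.le
    have hexp : x * (derivative (monicPolynomial F N)).eval x = N * x ^ N
        + ∑ i ∈ Finset.range N, F (i + 1) * (((N - (i + 1) : ℕ) : E) * x ^ (N - (i + 1))) := by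
      simp only [monicPolynomial, derivative_add, derivative_X_pow, derivative_sum,
        derivative_C_mul, eval_add, eval_mul, eval_C, eval_pow, eval_X, eval_finsetSum, mul_add,
        Finset.mul_sum, mul_left_comm x (F _), hm]
    have hpp : ‖(N : E)‖ = r ^ (2 * N) := by
      rw [D.deg, Nat.cast_mul, norm_mul, D.norm_p, ← pow_add, D.deg]
      congr 1
      ring
    rw [hexp]
    refine ultra_add_le ?_ (IsUltrametricDist.norm_sum_le_of_forall_le_of_nonneg (by positivity)
      fun i hi => ?_)
    · rw [norm_mul, hpp]
      exact mul_le_of_le_one_right (by positivity) (hxm N)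
    rw [Finset.mem_range] at hi
    by_cases h1 : i + 1 = N
    · rw [h1]
      simpa using by positivity
    by_cases h2 : i + 1 = p
    · have : N - p = p * (p - 1) := by rw [D.deg, Nat.mul_sub, mul_one]
      rw [h2, D.coeff_p, this, Nat.cast_mul, ← this,
        show p * a * (p * ((p - 1 : ℕ) : E) * x ^ (N - p))
          = p ^ 2 * a * (((p - 1 : ℕ) : E) * x ^ (N - p)) by ring, norm_mul, norm_mul, norm_pow,
        D.norm_p, D.norm_a, mul_one, ← pow_mul, mul_comm N]
      exact mul_le_of_le_one_right (by positivity) ((norm_natCast_mul_le _ _).trans (hxm _))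
    · rw [norm_mul]
      calc _ ≤ r ^ (2 * N) * 1 := mul_le_mul (D.norm_coeff _ (by omega) (by omega) h2)
            ((norm_natCast_mul_le _ _).trans (hxm _)) (norm_nonneg _) (by positivity)
        _ = _ := mul_one _
  by_contra! hcon
  have hlow : ∀ y ∈ ((monicPolynomial F N).roots.erase x).map (fun y => x - y), r ^ 2 ≤ ‖y‖ := by
    intro t ht
    obtain ⟨y, hy, rfl⟩ := Multiset.mem_map.1 ht
    rw [hnodup.mem_erase_iff, mem_roots hne, IsRoot, eval_monicPolynomial] at hy
    rw [norm_sub_rev, ← hxr]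
    exact hcon y hy.2 hy.1
  have hpr := pow_card_le_norm_prod (by positivity) _ hlow
  rw [Multiset.card_map, Multiset.card_erase_of_mem hxroot, hcard] at hpr
  have hev : (derivative (monicPolynomial F N)).eval x
      = (((monicPolynomial F N).roots.erase x).map (fun y => x - y)).prod :=
    hsplit.eval_root_derivative (monic_monicPolynomial F N) hxroot
  rw [norm_mul, hxr, hev] at hder
  have : r * (r ^ 2) ^ (N.pred) ≤ r ^ (2 * N) :=
    (mul_le_mul_of_nonneg_left hpr hr.le).trans hder
  rw [← pow_mul, ← pow_succ', Nat.pred_eq_sub_one] at this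
  exact this.not_gt (pow_lt_pow_right_of_lt_one₀ hr D.lt_one (by omega))

lemma exists_norm_pow_sub_lt (D : PolygonData p N r F a b g) [FiniteDimensional K E]
    [IsGalois K E] (hiso : ∀ (σ : E ≃ₐ[K] E) (z : E), ‖σ z‖ = ‖z‖)
    (hG : IsPGroup p (E ≃ₐ[K] E))
    (hperf : ∀ n : K, ‖algebraMap K E n‖ ≤ 1 → ∀ k : ℕ, ∃ c : K, ‖algebraMap K E c‖ ≤ 1 ∧
      ‖algebraMap K E c ^ p ^ k - algebraMap K E n‖ < 1)
    (hfix : ∀ σ : E ≃ₐ[K] E, σ a = a ∧ σ b = b ∧ σ g = g)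
    (hsplit : (monicPolynomial F N).Splits) (hsep : (monicPolynomial F N).Separable) {x : E}
    (hx : monicValue F N x = 0) :
    ∃ c : K, ‖algebraMap K E c‖ = 1 ∧ ‖a * b * algebraMap K E c ^ (p - 1) - g‖ < 1 := by
  have := Fact.mk D.prime
  have hp := D.odd_prime
  have hpE := D.norm_p_lt_one
  obtain ⟨y, hy, hyx, hlt⟩ := D.exists_root_norm_sub_lt hsplit hsep hx
  obtain ⟨z, hz1, hyz, hres⟩ := D.exists_eq_add_of_norm_sub_lt hx hy hlt
  have hx0 : 0 < ‖x‖ := (D.norm_root_pow hx).symm ▸ D.pos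
  have hz : ‖z‖ = 1 := by
    refine hz1.eq_of_not_lt fun hz => hyx (D.eq_of_norm_sub_lt hx hy ?_)
    rw [hyz, add_sub_cancel_left, norm_mul, norm_pow]
    exact mul_lt_of_lt_one_right (by positivity) hz
  have hab : ‖a * b‖ = 1 := by rw [norm_mul, D.norm_a, D.norm_b, one_mul]
  have hσz (σ : E ≃ₐ[K] E) : ‖σ z - z‖ < 1 := by
    obtain ⟨k, hk⟩ := hG σ
    obtain ⟨h1, h2, h3⟩ := hfix σ
    exact norm_apply_sub_lt_one hpE (hiso σ) (by rw [map_mul, h1, h2]) h3 hab hz hres hk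
  obtain ⟨c, hc⟩ := exists_norm_algebraMap_sub_lt_one hpE hG hperf hz hσz
  set c' := algebraMap K E c
  have hc1 : ‖c'‖ = 1 := by
    rw [← hz]
    refine (IsUltrametricDist.norm_eq_of_add_norm_lt_max (y := -z) ?_).trans (norm_neg _)
    rw [← sub_eq_add_neg, norm_neg, hz]
    exact lt_max_of_lt_right hc
  refine ⟨c, hc1, ?_⟩
  have : (a * b * c' ^ (p - 1) - g) * z
      = a * b * (c' ^ (p - 1) - z ^ (p - 1)) * z + (a * b * z ^ p - g * z) := by
    rw [← pow_sub_one_mul (by omega : p ≠ 0) z]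
    ring
  rw [← mul_one ‖_‖, ← hz, ← norm_mul, this, hz]
  refine ultra_add_lt ?_ hres
  rw [norm_mul, norm_mul, hab, hz, one_mul, mul_one]
  exact (norm_pow_sub_pow_le hc1.le hz.le _).trans_lt hc

end PolygonData

end Converse

section Core

variable {E K O κ : Type*} [NormedField E] [IsUltrametricDist E] [Field K] [Algebra K E]
  [CommRing O] [Field κ] [Finite κ]

/-- The criterion for a polynomial over a ring `O` reducing to a finite field `κ` and mapping to the
elements of `K` in the unit ball of the Galois extension `E`. -/
theorem PolygonData.isPGroup_iff [FiniteDimensional K E] [IsGalois K E] {p N : ℕ} [CharP κ p]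
    {r : ℝ} {ρ : O →+* κ} {ψ : O →+* E} {f : ℕ → O} {a b g : O}
    (D : PolygonData p N r (fun i => ψ (f i)) (ψ a) (ψ b) (ψ g))
    (hρ : Function.Surjective ρ) (hψ1 : ∀ t, ‖ψ t‖ ≤ 1) (hψρ : ∀ t, ‖ψ t‖ < 1 ↔ ρ t = 0)
    (hψK : ∀ n : K, ‖algebraMap K E n‖ ≤ 1 → ∃ t, ψ t = algebraMap K E n)
    (hKψ : ∀ t, ∃ n : K, algebraMap K E n = ψ t)
    (hiso : ∀ (σ : E ≃ₐ[K] E) (z : E), ‖σ z‖ = ‖z‖)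
    (hsplit : (monicPolynomial (fun i => ψ (f i)) N).Splits)
    (hsep : (monicPolynomial (fun i => ψ (f i)) N).Separable)
    (hroots : ∀ σ : E ≃ₐ[K] E,
      (∀ x, monicValue (fun i => ψ (f i)) N x = 0 → σ x = x) → σ = 1)
    (h3 : ∃ c : κ, c ≠ 0 ∧ c ^ (p - 1) = -ρ a / ρ b) :
    IsPGroup p (E ≃ₐ[K] E) ↔ ∃ c : κ, c ≠ 0 ∧ c ^ (p - 1) = ρ g / (ρ a * ρ b) := by
  have hpp := Fact.mk D.prime
  have hp := D.odd_prime
  have hN := D.three_mul_le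
  have hne {t : O} (ht : ‖ψ t‖ = 1) : ρ t ≠ 0 := fun h => ((hψρ t).2 h).ne ht
  have ha := hne D.norm_a
  have hb := hne D.norm_b
  have hg := hne D.norm_g
  have hfix (σ : E ≃ₐ[K] E) (t : O) : σ (ψ t) = ψ t := by
    obtain ⟨n, hn⟩ := hKψ t
    rw [← hn, AlgEquiv.commutes]
  constructor
  · intro hG
    obtain ⟨x, hx⟩ : ∃ x, monicValue (fun i => ψ (f i)) N x = 0 := by
      obtain ⟨x, hx⟩ := hsplit.exists_eval_eq_zero (by
        rw [degree_eq_natDegree (monic_monicPolynomial _ _).ne_zero, natDegree_monicPolynomial]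
        exact_mod_cast (by omega : N ≠ 0))
      exact ⟨x, by rwa [eval_monicPolynomial] at hx⟩
    have hperf (n : K) (hn : ‖algebraMap K E n‖ ≤ 1) (k : ℕ) : ∃ c : K, ‖algebraMap K E c‖ ≤ 1 ∧
        ‖algebraMap K E c ^ p ^ k - algebraMap K E n‖ < 1 := by
      obtain ⟨t, ht⟩ := hψK n hn
      obtain ⟨s, hs⟩ := (bijective_iterateFrobenius κ p k).2 (ρ t)
      obtain ⟨u, rfl⟩ := hρ s
      obtain ⟨c, hc⟩ := hKψ u
      refine ⟨c, hc ▸ hψ1 u, ?_⟩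
      rw [hc, ← ht, ← map_pow, ← map_sub, hψρ, map_sub, map_pow, ← iterateFrobenius_def, hs,
        sub_self]
    obtain ⟨c, hc1, hc⟩ := D.exists_norm_pow_sub_lt hiso hG hperf
      (fun σ => ⟨hfix σ _, hfix σ _, hfix σ _⟩) hsplit hsep hx
    obtain ⟨t, ht⟩ := hψK c hc1.le
    rw [← ht, ← map_pow, ← map_mul, ← map_mul, ← map_sub, hψρ, map_sub, map_mul, map_mul, map_pow,
      sub_eq_zero] at hc
    refine ⟨ρ t, hne (ht ▸ hc1), ?_⟩
    rw [← hc, mul_div_cancel_left₀ _ (mul_ne_zero ha hb)]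
  · rintro ⟨c, -, hc⟩
    obtain ⟨d, rfl⟩ := hρ c
    obtain ⟨c₀, -, hc₀⟩ := h3
    obtain ⟨s, rfl⟩ := (bijective_frobenius κ p).2 c₀
    obtain ⟨e, rfl⟩ := hρ s
    rw [frobenius_def] at hc₀
    intro σ
    refine ⟨2, hroots _ fun x hx => ?_⟩
    have hroot (n : ℕ) : monicValue (fun i => ψ (f i)) N ((σ ^ n) x) = 0 := by
      have : monicValue (fun i => ψ (f i)) N ((σ ^ n) x)
          = (σ ^ n) (monicValue (fun i => ψ (f i)) N x) := by
        simp only [monicValue, map_add, map_sum, map_mul, map_pow, hfix]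
      rw [this, hx, map_zero]
    refine D.pow_sq_apply_eq_self (fun n z => hiso _ z) hroot (hfix σ e) (hψ1 e) ?_
      (hfix σ d) (hψ1 d) ?_
    · rw [← map_pow, ← map_mul, ← map_add, hψρ, map_add, map_mul, map_pow, pow_mul,
        hc₀, mul_div_cancel₀ _ hb, neg_add_cancel]
    · rw [← map_pow, ← map_mul, ← map_mul, ← map_sub, hψρ, map_sub, map_mul, map_mul, map_pow,
        hc, mul_div_cancel₀ _ (mul_ne_zero ha hb), sub_self]

end Core

section Eisenstein

variable {R : Type*} [CommRing R]

lemma coeff_monicPolynomial (F : ℕ → R) {n m : ℕ} (h : m < n) :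
    (monicPolynomial F n).coeff m = F (n - m) := by
  rw [monicPolynomial, coeff_add, coeff_X_pow, if_neg h.ne, zero_add, finsetSum_coeff,
    Finset.sum_eq_single (n - m - 1)]
  · rw [coeff_C_mul, coeff_X_pow, if_pos (by omega), mul_one, Nat.sub_add_cancel (by omega)]
  · intro i hi hi'
    rw [Finset.mem_range] at hi
    rw [coeff_C_mul, coeff_X_pow, if_neg (by omega), mul_zero]
  · intro hi
    exact absurd (Finset.mem_range.2 (by omega)) hi

lemma irreducible_monicPolynomial [IsDomain R] {q : R} (hq : (Ideal.span {q}).IsPrime)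
    {F : ℕ → R} {n : ℕ} (hn : 0 < n) (h : ∀ i, 1 ≤ i → i ≤ n → q ∣ F i) (h' : ¬q ^ 2 ∣ F n) :
    Irreducible (monicPolynomial F n) := by
  have hE : (monicPolynomial F n).IsEisensteinAt (Ideal.span {q}) := by
    refine ⟨?_, fun {m} hm => ?_, ?_⟩
    · rw [monic_monicPolynomial]
      exact fun h1 => hq.ne_top ((Ideal.eq_top_iff_one _).2 h1)
    · rw [natDegree_monicPolynomial] at hm
      rw [coeff_monicPolynomial F hm, Ideal.mem_span_singleton]
      exact h _ (by omega) (by omega)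
    · rwa [coeff_monicPolynomial F hn, Ideal.span_singleton_pow, Ideal.mem_span_singleton]
  exact hE.irreducible hq (monic_monicPolynomial F n).isPrimitive
    (by rwa [natDegree_monicPolynomial])

end Eisenstein

section SpectralNorm

variable {p : ℕ} [Fact p.Prime] {K : Type} [Field K] [Algebra ℚ_[p] K]

instance isScalarTower_zpAlgebra : IsScalarTower ℤ_[p] ℚ_[p] K :=
  IsScalarTower.of_algebraMap_eq fun _ => rfl

lemma spectralNorm_le_one_iff_isIntegral [FiniteDimensional ℚ_[p] K] (x : K) :
    spectralNorm ℚ_[p] K x ≤ 1 ↔ IsIntegral ℤ_[p] x := by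
  have hx : IsIntegral ℚ_[p] x := IsIntegral.of_finite ℚ_[p] x
  rw [spectralNorm, spectralValue_le_one_iff (minpoly.monic hx)]
  constructor
  · intro h
    have hl : minpoly ℚ_[p] x ∈ lifts (algebraMap ℤ_[p] ℚ_[p]) := by
      rw [lifts_iff_coeff_lifts]
      exact fun n => ⟨⟨_, h n⟩, rfl⟩
    obtain ⟨q, hq, -, hmonic⟩ := lifts_and_natDegree_eq_and_monic hl (minpoly.monic hx)
    refine ⟨q, hmonic, ?_⟩
    rw [IsScalarTower.algebraMap_eq ℤ_[p] ℚ_[p] K, ← eval₂_map, hq]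
    exact minpoly.aeval ℚ_[p] x
  · intro h n
    rw [minpoly.isIntegrallyClosed_eq_field_fractions' ℚ_[p] h, coeff_map]
    exact PadicInt.norm_le_one _

lemma spectralNorm_algebraMap {E : Type*} [Field E] [Algebra K E] [Algebra ℚ_[p] E]
    [IsScalarTower ℚ_[p] K E] (x : K) :
    spectralNorm ℚ_[p] E (algebraMap K E x) = spectralNorm ℚ_[p] K x := by
  rw [spectralNorm, spectralNorm, minpoly.algebraMap_eq (algebraMap K E).injective]

end SpectralNorm

section Unramified

variable {p : ℕ} [Fact p.Prime] {K : Type} [Field K] [Algebra ℚ_[p] K] [FiniteDimensional ℚ_[p] K]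
  {κ : Type} [Field κ] [Finite κ] [CharP κ p] {ρ : integralClosure ℤ_[p] K →+* κ}

lemma spectralNorm_natCast_prime (E : Type*) [Field E] [Algebra ℚ_[p] E] :
    spectralNorm ℚ_[p] E p = (p : ℝ)⁻¹ := by
  rw [← map_natCast (algebraMap ℚ_[p] E), spectralNorm_extends, Padic.norm_p]

/-- The criterion for the Galois group of a finite Galois extension `E` of `K` generated by the
roots of the given polynomial. -/
lemma isPGroup_iff_of_splits (hodd : Odd p)
    (hKloc : ∀ x : integralClosure ℤ_[p] K, ¬IsUnit x → (p : integralClosure ℤ_[p] K) ∣ x)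
    (hρ : Function.Surjective ρ)
    (hker : RingHom.ker ρ = Ideal.span {(p : integralClosure ℤ_[p] K)})
    {N : ℕ} (hN : N = p * p) {f : ℕ → integralClosure ℤ_[p] K} {a b g : integralClosure ℤ_[p] K}
    (ha : f p = p * a) (hg : f (p + 1) = p ^ 2 * g) (hb : f N = p * b)
    (ha0 : ρ a ≠ 0) (hb0 : ρ b ≠ 0) (hg0 : ρ g ≠ 0)
    (hf2 : ∀ i, 1 ≤ i → i < N → i ≠ p → (p : integralClosure ℤ_[p] K) ^ 2 ∣ f i)
    (hf3 : ∀ i, p + 2 ≤ i → i < N → i.Coprime p → (p : integralClosure ℤ_[p] K) ^ 3 ∣ f i)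
    (h3 : ∃ c : κ, c ≠ 0 ∧ c ^ (p - 1) = -ρ a / ρ b)
    (E : Type*) [Field E] [Algebra K E] [FiniteDimensional K E] [IsGalois K E]
    (hsplit : ((monicPolynomial (fun i => (f i : K)) N).map (algebraMap K E)).Splits)
    (hsep : (monicPolynomial (fun i => (f i : K)) N).Separable)
    (hroots : ∀ σ : E ≃ₐ[K] E,
      (∀ x, aeval x (monicPolynomial (fun i => (f i : K)) N) = 0 → σ x = x) → σ = 1) :
    IsPGroup p (E ≃ₐ[K] E) ↔ ∃ c : κ, c ≠ 0 ∧ c ^ (p - 1) = ρ g / (ρ a * ρ b) := by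
  have hp : p.Prime := Fact.out
  have hp1 := hp.one_lt
  have hp3 : 3 ≤ p := by
    obtain ⟨k, hk⟩ := hodd
    omega
  let _ : Algebra ℚ_[p] E := ((algebraMap K E).comp (algebraMap ℚ_[p] K)).toAlgebra
  have : IsScalarTower ℚ_[p] K E := .of_algebraMap_eq fun _ => rfl
  have : FiniteDimensional ℚ_[p] E := FiniteDimensional.trans ℚ_[p] K E
  let _ : NormedField E := spectralNorm.normedField ℚ_[p] E
  have hnorm (x : E) : ‖x‖ = spectralNorm ℚ_[p] E x := rfl
  have : IsUltrametricDist E :=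
    IsUltrametricDist.isUltrametricDist_of_isNonarchimedean_norm isNonarchimedean_spectralNorm
  have hpE : ‖(p : E)‖ = (p : ℝ)⁻¹ := spectralNorm_natCast_prime E
  have hp0' : (0 : ℝ) < (p : ℝ)⁻¹ := by positivity
  have hp1' : (p : ℝ)⁻¹ < 1 := inv_lt_one_of_one_lt₀ (by exact_mod_cast hp1)
  set ψ : integralClosure ℤ_[p] K →+* E :=
    (algebraMap K E).comp (algebraMap (integralClosure ℤ_[p] K) K) with hψ
  have hψK (n : K) (hn : ‖algebraMap K E n‖ ≤ 1) : ∃ t, ψ t = algebraMap K E n := by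
    rw [hnorm, spectralNorm_algebraMap, spectralNorm_le_one_iff_isIntegral] at hn
    exact ⟨⟨n, hn⟩, rfl⟩
  have hψ1 (t : integralClosure ℤ_[p] K) : ‖ψ t‖ ≤ 1 := by
    have := (spectralNorm_le_one_iff_isIntegral (t : K)).2 t.2
    rwa [← spectralNorm_algebraMap (E := E)] at this
  have hψp (k : ℕ) {t : integralClosure ℤ_[p] K} (h : (p : integralClosure ℤ_[p] K) ^ k ∣ t) :
      ‖ψ t‖ ≤ ‖(p : E)‖ ^ k := by
    obtain ⟨s, rfl⟩ := h
    rw [map_mul, map_pow, map_natCast, norm_mul, norm_pow]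
    exact mul_le_of_le_one_right (by positivity) (hψ1 s)
  have hρp (t : integralClosure ℤ_[p] K) : ρ t = 0 ↔ (p : integralClosure ℤ_[p] K) ∣ t := by
    rw [← RingHom.mem_ker, hker, Ideal.mem_span_singleton]
  have hψu {t : integralClosure ℤ_[p] K} (h : ρ t ≠ 0) : ‖ψ t‖ = 1 := by
    obtain ⟨u, hu⟩ := (not_not.1 (mt (hKloc t) (mt (hρp t).2 h))).exists_right_inv
    have h1 : ‖ψ t‖ * ‖ψ u‖ = 1 := by rw [← norm_mul, ← map_mul, hu, map_one, norm_one]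
    refine (hψ1 t).antisymm ?_
    rw [← h1]
    exact mul_le_of_le_one_right (norm_nonneg _) (hψ1 u)
  have hψρ (t : integralClosure ℤ_[p] K) : ‖ψ t‖ < 1 ↔ ρ t = 0 := by
    refine ⟨fun h => ?_, fun h => ?_⟩
    · by_contra h0
      exact h.ne (hψu h0)
    · rw [hρp, ← pow_one (p : integralClosure ℤ_[p] K)] at h
      refine (hψp 1 h).trans_lt ?_
      rwa [pow_one, hpE]
  have hN0 : N ≠ 0 := by rw [hN]; positivity
  have hr : (((p : ℝ)⁻¹) ^ ((N : ℝ)⁻¹)) ^ N = (p : ℝ)⁻¹ :=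
    Real.rpow_inv_natCast_pow hp0'.le hN0
  have hNlt : p + 1 < N := by rw [hN]; nlinarith
  have D : PolygonData p N (((p : ℝ)⁻¹) ^ ((N : ℝ)⁻¹)) (fun i => ψ (f i)) (ψ a) (ψ b) (ψ g) :=
    { odd_prime := hp3
      prime := hp
      deg := hN
      pos := by positivity
      lt_one := Real.rpow_lt_one hp0'.le hp1' (by positivity)
      norm_p := by rw [hr, hpE]
      coeff_p := by rw [ha, map_mul, map_natCast]
      coeff_succ := by rw [hg, map_mul, map_pow, map_natCast]
      coeff_last := by rw [hb, map_mul, map_natCast]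
      norm_a := hψu ha0
      norm_b := hψu hb0
      norm_g := hψu hg0
      norm_coeff := fun i h1 h2 h => by
        rw [mul_comm 2, pow_mul, hr, ← hpE]
        exact hψp 2 (hf2 i h1 h2 h)
      norm_coeff_coprime := fun i h1 h2 h => by
        rw [mul_comm 3, pow_mul, hr, ← hpE]
        exact hψp 3 (hf3 i h1 h2 h) }
  have hmap : (monicPolynomial (fun i => (f i : K)) N).map (algebraMap K E)
      = monicPolynomial (fun i => ψ (f i)) N := map_monicPolynomial _ _ _
  refine D.isPGroup_iff hρ hψ1 hψρ hψK (fun t => ⟨t, rfl⟩) (fun σ z => ?_) (hmap ▸ hsplit)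
    (hmap ▸ hsep.map) (fun σ h => hroots σ fun x hx => h x ?_) h3
  · exact (spectralNorm_eq_of_equiv (σ.restrictScalars ℚ_[p]) z).symm
  · rw [← eval_monicPolynomial, ← hmap, eval_map_algebraMap, hx]

end Unramified

section NormalClosure

variable {K L Ω : Type*} [Field K] [Field L] [Algebra K L] [Field Ω] [Algebra K Ω]

/-- An automorphism of the normal closure of `K(π)` fixing all conjugates of `π` is trivial. -/
lemma algEquiv_normalClosure_eq_one {π : L} (hgen : adjoin K {π} = ⊤)
    {σ : normalClosure K L Ω ≃ₐ[K] normalClosure K L Ω} {P : K[X]} (hP : aeval π P = 0)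
    (h : ∀ x, aeval x P = 0 → σ x = x) : σ = 1 := by
  have hle : normalClosure K L Ω ≤ lift (fixedField (Subgroup.zpowers σ)) := by
    refine iSup_le fun φ => ?_
    rintro _ ⟨l, rfl⟩
    set φ' : L →ₐ[K] normalClosure K L Ω := φ.codRestrict (normalClosure K L Ω).toSubalgebra
      fun l => φ.fieldRange_le_normalClosure ⟨l, rfl⟩
    have htop : (⊤ : IntermediateField K L)
        ≤ (fixedField (Subgroup.zpowers σ)).comap φ' := by
      rw [← hgen, adjoin_le_iff, Set.singleton_subset_iff]
      refine (mem_fixedField_iff _ _).2 fun τ hτ => ?_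
      have hσ : σ ∈ MulAction.stabilizer (normalClosure K L Ω ≃ₐ[K] normalClosure K L Ω) (φ' π) :=
        h (φ' π) (by rw [aeval_algHom_apply, hP, map_zero])
      exact Subgroup.zpowers_le.2 hσ hτ
    exact (mem_lift (φ' l)).2 (htop mem_top)
  ext e
  exact congrArg Subtype.val ((mem_fixedField_iff _ _).1 ((mem_lift e).1 (hle e.2)) σ
    (Subgroup.mem_zpowers σ))

end NormalClosure

lemma irreducible_monicPolynomial_coe {p : ℕ} [Fact p.Prime] {K : Type} [Field K]
    [Algebra ℚ_[p] K] [FiniteDimensional ℚ_[p] K] {q : integralClosure ℤ_[p] K}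
    (hq : (Ideal.span {q}).IsPrime) {n : ℕ} (hn : 0 < n) {F : ℕ → integralClosure ℤ_[p] K}
    (h : ∀ i, 1 ≤ i → i ≤ n → q ∣ F i) (h' : ¬q ^ 2 ∣ F n) :
    Irreducible (monicPolynomial (fun i => (F i : K)) n) := by
  have := integralClosure.isIntegrallyClosedOfFiniteExtension (R := ℤ_[p]) ℚ_[p] (L := K)
  have := integralClosure.isFractionRing_of_finite_extension (A := ℤ_[p]) ℚ_[p] K
  have hirr := irreducible_monicPolynomial hq hn h h'
  rw [Monic.irreducible_iff_irreducible_map_fraction_map (K := K) (monic_monicPolynomial F n),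
    map_monicPolynomial] at hirr
  exact hirr

/-- With `f` an Eisenstein polynomial of degree `p²` over a finite unramified
`K/ℚ_p` (`p` odd), satisfying (R1), (R2), and `−F_p/F_{p²} ∈ (κ_K^×)^{p−1}`, let `L = K(π)` and
let `L̃` be the normal closure of `L` over `K` inside an algebraic closure.  Then `Gal(L̃/K)` is a
`p`-group if and only if `G_{p+1}/(F_p·F_{p²}) ∈ (κ_K^×)^{p−1}`. -/
theorem stmt12 (p : ℕ) [Fact (Nat.Prime p)] (hodd : Odd p)
    (K : Type) [Field K] [Algebra ℚ_[p] K] [FiniteDimensional ℚ_[p] K]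
    (hKloc : ∀ x : integralClosure ℤ_[p] K, ¬IsUnit x → (p : integralClosure ℤ_[p] K) ∣ x)
    (hKp : ¬IsUnit (p : integralClosure ℤ_[p] K))
    -- the residue field
    (κ : Type) [Field κ] [Finite κ] [CharP κ p]
    (ρ : integralClosure ℤ_[p] K →+* κ) (hρ : Function.Surjective ρ)
    (hker : RingHom.ker ρ = Ideal.span {(p : integralClosure ℤ_[p] K)})
    -- an Eisenstein polynomial of degree `p²`
    (f : ℕ → integralClosure ℤ_[p] K)
    (hfE : ∀ i, 1 ≤ i → i ≤ p ^ 2 → (p : integralClosure ℤ_[p] K) ∣ f i)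
    (hfE' : ¬(p : integralClosure ℤ_[p] K) ^ 2 ∣ f (p ^ 2))
    -- witnesses for `F_p = ρ a`, `F_{p²} = ρ b`, `G_i = ρ (g i)`
    (a b : integralClosure ℤ_[p] K) (g : ℕ → integralClosure ℤ_[p] K)
    (ha : f p = p * a) (hb : f (p ^ 2) = p * b)
    (hg : ∀ i, 1 ≤ i → i < p ^ 2 → i ≠ p → f i = p ^ 2 * g i)
    -- (R1)
    (hR1a : ¬(p : integralClosure ℤ_[p] K) ^ 2 ∣ f p)
    (hR1b : ∀ i, 2 ≤ i → i ≤ p - 1 → Nat.Coprime i p →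
      (p : integralClosure ℤ_[p] K) ^ 2 ∣ f (p * i))
    -- (R2)
    (hR2a : ∀ i, 1 ≤ i → i ≤ p - 1 → Nat.Coprime i p →
      (p : integralClosure ℤ_[p] K) ^ 2 ∣ f i)
    (hR2b : ¬(p : integralClosure ℤ_[p] K) ^ 3 ∣ f (p + 1))
    (hR2c : ∀ i, p + 2 ≤ i → i ≤ p ^ 2 - 1 → Nat.Coprime i p →
      (p : integralClosure ℤ_[p] K) ^ 3 ∣ f i)
    -- `−F_p/F_{p²} ∈ (κ_K^×)^{p−1}`
    (h3 : ∃ c : κ, c ≠ 0 ∧ c ^ (p - 1) = -ρ a / ρ b)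
    -- the extension `L = K(π)` generated by a root of `f`
    (L : Type) [Field L] [Algebra K L] (π : L)
    (hπ : aeval π (X ^ p ^ 2 + ∑ i ∈ Finset.range (p ^ 2),
        C ((f (i + 1) : K)) * X ^ (p ^ 2 - (i + 1))) = 0)
    (hgen : adjoin K {π} = ⊤)
    -- an algebraic closure of `K` containing `L`, and the normal closure `L̃` of `L/K` inside it
    (Ω : Type) [Field Ω] [Algebra K Ω] [Algebra L Ω] [IsScalarTower K L Ω] [IsAlgClosure K Ω] :
    IsPGroup p (normalClosure K L Ω ≃ₐ[K] normalClosure K L Ω) ↔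
      ∃ c : κ, c ≠ 0 ∧ c ^ (p - 1) = ρ (g (p + 1)) / (ρ a * ρ b) := by
  have hp : p.Prime := Fact.out
  have hp3 : 3 ≤ p := by
    obtain ⟨k, hk⟩ := hodd
    have := hp.two_le
    omega
  have hpp : p + 1 < p ^ 2 := by nlinarith
  have hρp (t : integralClosure ℤ_[p] K) : ρ t = 0 ↔ (p : integralClosure ℤ_[p] K) ∣ t := by
    rw [← RingHom.mem_ker, hker, Ideal.mem_span_singleton]
  have hgp : f (p + 1) = p ^ 2 * g (p + 1) := hg (p + 1) (by omega) hpp (by omega)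
  have ha0 : ρ a ≠ 0 := fun h => hR1a <| by
    rw [ha, sq]
    exact mul_dvd_mul_left _ ((hρp a).1 h)
  have hb0 : ρ b ≠ 0 := fun h => hfE' <| by
    rw [hb, sq]
    exact mul_dvd_mul_left _ ((hρp b).1 h)
  have hg0 : ρ (g (p + 1)) ≠ 0 := fun h => hR2b <| by
    rw [hgp, pow_succ]
    exact mul_dvd_mul_left _ ((hρp _).1 h)
  have : CharZero K := charZero_of_injective_algebraMap (algebraMap ℚ_[p] K).injective
  have hirr := irreducible_monicPolynomial_coe (hker ▸ RingHom.ker_isPrime ρ)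
    (by positivity : 0 < p ^ 2) hfE hfE'
  have hP : aeval π (monicPolynomial (fun i => (f i : K)) (p ^ 2)) = 0 := hπ
  have hmin : minpoly K π = monicPolynomial (fun i => (f i : K)) (p ^ 2) :=
    (minpoly.eq_of_irreducible_of_monic hirr hP (monic_monicPolynomial _ _)).symm
  have hint : IsIntegral K π := ⟨_, monic_monicPolynomial _ _, hP⟩
  have : FiniteDimensional K L := by
    have := adjoin.finiteDimensional hint
    rw [hgen] at this
    exact topEquiv.toLinearEquiv.finiteDimensional
  have : Normal K Ω := normal_iff.2 fun x =>
    ⟨(IsAlgClosure.isAlgebraic (R := K) (K := Ω)).isAlgebraic x |>.isIntegral,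
      haveI := IsAlgClosure.isAlgClosed K (K := Ω); IsAlgClosed.splits _⟩
  have : IsGalois K (normalClosure K L Ω) := {}
  refine isPGroup_iff_of_splits hodd hKloc hρ hker (sq p) ha hgp hb ha0 hb0 hg0
    (fun i h1 h2 h => ⟨g i, hg i h1 h2 h⟩) (fun i h1 h2 h => hR2c i h1 (by omega) h) h3 _ ?_
    hirr.separable fun σ h => algEquiv_normalClosure_eq_one hgen hP h
  rw [← hmin, ← minpoly.algebraMap_eq (algebraMap L (normalClosure K L Ω)).injective]
  exact Normal.splits inferInstance _
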